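/- arXiv:math/0612382 — 5 statements merged into one kernel-verified Lean document; each statement's English description precedes it below -/
import Mathlib

section
/- Theorem 4.3 (recursion form for the binary-tree cover-time recursion). Let Q(u) = 2u − u², and let Ḡ be the kernel defined in the context. Define distribution functions {F_n}_{n≥0} by F̄₀(x) = 1_{x < 0} and F̄_{n+1}(x) = −∫_ℝ Ḡ(y, x − y) dQ(F̄_n(y)) (Lebesgue–Stieltjes integral with respect to the nonincreasing function y ↦ Q(F̄_n(y))). Then the sequence {F_n^s}_{n≥0} is tight after centering; equivalently, the random variables β_n^s = β_n − Med(F_n), where β_n has distribution function F_n, form a tight sequence. -/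
open MeasureTheory Filter Set

/-- `MemD u` : `u` belongs to the class `𝒟`, i.e. `u` is nonincreasing, right-continuous,
`[0,1]`-valued, with `u → 1` at `-∞` and `u → 0` at `+∞` (so `1 - u` is a distribution
function). -/
def MemD (u : ℝ → ℝ) : Prop :=
  Antitone u ∧ (∀ x, ContinuousWithinAt u (Set.Ici x) x) ∧
    (∀ x, u x ∈ Set.Icc (0 : ℝ) 1) ∧
    Filter.Tendsto u Filter.atBot (nhds 1) ∧ Filter.Tendsto u Filter.atTop (nhds 0)

open Classical in
/-- The Lebesgue–Stieltjes measure `d(1-u) = -du` associated with a nonincreasing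
right-continuous function `u` (junk value `0` if `u` is not of this form). -/
noncomputable def lsMeasure (u : ℝ → ℝ) : MeasureTheory.Measure ℝ :=
  if h : Monotone (fun x => 1 - u x) ∧
      ∀ x, ContinuousWithinAt (fun x => 1 - u x) (Set.Ici x) x then
    StieltjesFunction.measure ⟨fun x => 1 - u x, h.1, h.2⟩
  else 0

/-- The convolution operation `(Ḡ ⊛ u)(x) = -∫ Ḡ(y, x - y) du(y)`. -/
noncomputable def convD (G : ℝ → ℝ → ℝ) (u : ℝ → ℝ) (x : ℝ) : ℝ :=
  ∫ y, G y (x - y) ∂(lsMeasure u)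

/-- The median `Med(F) = inf {x : F(x) ≥ 1/2}` of a distribution function. -/
noncomputable def Med (F : ℝ → ℝ) : ℝ := sInf {x | 1 / 2 ≤ F x}

/-- Tightness of the recentered distribution functions `Fₙˢ(x) = Fₙ(x + Med(Fₙ))`:
for every `ε > 0` there is `A > 0` with `Fₙˢ(A) - Fₙˢ(-A) > 1 - ε` for all `n`. -/
def TightAfterCentering (F : ℕ → ℝ → ℝ) : Prop :=
  ∀ ε : ℝ, 0 < ε → ∃ A : ℝ, 0 < A ∧
    ∀ n, 1 - ε < F n (A + Med (F n)) - F n (-A + Med (F n))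

/-- `Ḡ(y, x - y)` for `y ≥ 0` in the cover-time problem, written as a function of `y`
and `s = x - y`: it equals `1` if `x = s + y ≤ 0` and
`e^{-(x² + y²)} ∑ₖ (x^{2k}/k!) ∑_{j ≥ k} y^{2j}/j!` if `x > 0`. -/
noncomputable def Gker0 (y s : ℝ) : ℝ :=
  if s + y ≤ 0 then 1 else
    Real.exp (-((s + y) ^ 2 + y ^ 2)) *
      ∑' k : ℕ, ((s + y) ^ (2 * k) / (Nat.factorial k : ℝ)) *
        ∑' j : ℕ, (if k ≤ j then y ^ (2 * j) / (Nat.factorial j : ℝ) else 0)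

/-- The cover-time kernel `Ḡ(y, s)` of Aldous's recursion, with `Ḡ(y, s) = Ḡ(0, s)` for
`y < 0`. -/
noncomputable def Gker (y s : ℝ) : ℝ := if 0 ≤ y then Gker0 y s else Gker0 0 s

/-- The Poisson weight `e^{-s} s^k / k!`. -/
noncomputable def poissonWeight (k : ℕ) (s : ℝ) : ℝ := Real.exp (-s) * (s ^ k / (k.factorial : ℝ))

/-- The Poisson tail `∑_{j ≥ k} e^{-s} s^j / j!`, written as a finite complement. -/
noncomputable def poissonTail (k : ℕ) (s : ℝ) : ℝ :=
  1 - ∑ j ∈ Finset.range k, poissonWeight j s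

/-- The Poisson weight shifted by one index, with value `0` at `k = 0`. -/
noncomputable def poissonWeightPred (k : ℕ) (s : ℝ) : ℝ :=
  match k with
  | 0 => 0
  | k + 1 => poissonWeight k s

lemma poissonWeight_nonneg (k : ℕ) {s : ℝ} (hs : 0 ≤ s) : 0 ≤ poissonWeight k s := by
  unfold poissonWeight; positivity

lemma poissonWeightPred_nonneg (k : ℕ) {s : ℝ} (hs : 0 ≤ s) : 0 ≤ poissonWeightPred k s := by
  cases k with
  | zero => exact le_rfl
  | succ k => exact poissonWeight_nonneg k hs

lemma hasSum_pow_div_factorial (s : ℝ) :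
    HasSum (fun k : ℕ => s ^ k / (k.factorial : ℝ)) (Real.exp s) := by
  rw [Real.exp_eq_exp_ℝ]
  exact NormedSpace.expSeries_div_hasSum_exp s

lemma hasSum_poissonWeight (s : ℝ) : HasSum (fun k => poissonWeight k s) 1 := by
  have h := (hasSum_pow_div_factorial s).mul_left (Real.exp (-s))
  rwa [← Real.exp_add, neg_add_cancel, Real.exp_zero] at h

lemma hasSum_poissonTail (k : ℕ) (s : ℝ) :
    HasSum (fun d => poissonWeight (d + k) s) (poissonTail k s) := by
  refine (hasSum_nat_add_iff (f := fun j => poissonWeight j s) k).2 ?_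
  simpa [poissonTail] using hasSum_poissonWeight s

lemma poissonTail_succ (k : ℕ) (s : ℝ) :
    poissonTail (k + 1) s = poissonTail k s - poissonWeight k s := by
  unfold poissonTail; rw [Finset.sum_range_succ]; ring

lemma poissonTail_nonneg (k : ℕ) {s : ℝ} (hs : 0 ≤ s) : 0 ≤ poissonTail k s :=
  (hasSum_poissonTail k s).nonneg fun _ => poissonWeight_nonneg _ hs

lemma poissonTail_le_one (k : ℕ) {s : ℝ} (hs : 0 ≤ s) : poissonTail k s ≤ 1 := by
  have := Finset.sum_nonneg fun j (_ : j ∈ Finset.range k) => poissonWeight_nonneg j hs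
  unfold poissonTail; linarith

lemma poissonWeight_le (k : ℕ) {s L : ℝ} (hs : 0 ≤ s) (hL : s ≤ L) :
    poissonWeight k s ≤ L ^ k / (k.factorial : ℝ) := by
  unfold poissonWeight
  have h1 : Real.exp (-s) ≤ 1 := Real.exp_le_one_iff.2 (by linarith)
  calc Real.exp (-s) * (s ^ k / (k.factorial : ℝ)) ≤ 1 * (s ^ k / (k.factorial : ℝ)) := by gcongr
    _ ≤ _ := by rw [one_mul]; gcongr

lemma poissonWeight_le_one (k : ℕ) {s : ℝ} (hs : 0 ≤ s) : poissonWeight k s ≤ 1 :=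
  le_hasSum (hasSum_poissonWeight s) k fun _ _ => poissonWeight_nonneg _ hs

lemma poissonWeightPred_le_one (k : ℕ) {s : ℝ} (hs : 0 ≤ s) : poissonWeightPred k s ≤ 1 := by
  cases k with
  | zero => exact zero_le_one
  | succ k => exact poissonWeight_le_one k hs

lemma hasDerivAt_poissonWeight (k : ℕ) (s : ℝ) :
    HasDerivAt (poissonWeight k) (poissonWeightPred k s - poissonWeight k s) s := by
  have he : HasDerivAt (fun s : ℝ => Real.exp (-s)) (-Real.exp (-s)) s := by
    simpa using (hasDerivAt_neg s).exp
  have h := he.mul ((hasDerivAt_pow k s).div_const (k.factorial : ℝ))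
  refine h.congr_deriv ?_
  cases k with
  | zero => simp [poissonWeight, poissonWeightPred]
  | succ k =>
    have : ((k : ℝ) + 1) ≠ 0 := by positivity
    have h2 : (k.factorial : ℝ) ≠ 0 := by positivity
    simp only [poissonWeight, poissonWeightPred, Nat.factorial_succ, Nat.cast_mul, Nat.cast_add,
      Nat.cast_one, Nat.add_sub_cancel]
    field_simp
    ring

lemma hasDerivAt_poissonTail (k : ℕ) (s : ℝ) :
    HasDerivAt (poissonTail k) (poissonWeightPred k s) s := by
  induction k with
  | zero =>
    have : poissonTail 0 = fun _ => (1 : ℝ) := by ext; simp [poissonTail]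
    rw [this]; exact hasDerivAt_const _ _
  | succ k ih =>
    have : poissonTail (k + 1) = fun s => poissonTail k s - poissonWeight k s := by
      ext; exact poissonTail_succ _ _
    rw [this]
    refine (ih.sub (hasDerivAt_poissonWeight k s)).congr_deriv ?_
    simp [poissonWeightPred]

/-- The cover-time kernel `Ḡ(y, x - y)` for `x, y ≥ 0`, as a Poisson mixture. -/
noncomputable def coverKer (x y : ℝ) : ℝ :=
  ∑' k : ℕ, poissonWeight k (x ^ 2) * poissonTail k (y ^ 2)

lemma summable_weight_mul {s : ℝ} (hs : 0 ≤ s) {f : ℕ → ℝ} (hf : ∀ k, 0 ≤ f k)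
    (hf' : ∀ k, f k ≤ 1) : Summable fun k => poissonWeight k s * f k :=
  Summable.of_nonneg_of_le (fun k => mul_nonneg (poissonWeight_nonneg k hs) (hf k))
    (fun k => mul_le_of_le_one_right (poissonWeight_nonneg k hs) (hf' k))
    (hasSum_poissonWeight s).summable

lemma summable_coverKer (x y : ℝ) :
    Summable fun k => poissonWeight k (x ^ 2) * poissonTail k (y ^ 2) :=
  summable_weight_mul (sq_nonneg x) (fun k => poissonTail_nonneg k (sq_nonneg y))
    fun k => poissonTail_le_one k (sq_nonneg y)

lemma coverKer_nonneg (x y : ℝ) : 0 ≤ coverKer x y :=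
  tsum_nonneg fun k => mul_nonneg (poissonWeight_nonneg k (sq_nonneg x))
    (poissonTail_nonneg k (sq_nonneg y))

lemma coverKer_le_one (x y : ℝ) : coverKer x y ≤ 1 := by
  rw [← (hasSum_poissonWeight (x ^ 2)).tsum_eq]
  exact (summable_coverKer x y).tsum_le_tsum
    (fun k => mul_le_of_le_one_right (poissonWeight_nonneg k (sq_nonneg x))
      (poissonTail_le_one k (sq_nonneg y))) (hasSum_poissonWeight _).summable

lemma coverKer_zero_left (y : ℝ) : coverKer 0 y = 1 := by
  unfold coverKer
  rw [tsum_eq_single 0]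
  · simp [poissonWeight, poissonTail]
  · intro k hk; simp [poissonWeight, hk]

lemma coverKer_zero_right (x : ℝ) : coverKer x 0 = Real.exp (-x ^ 2) := by
  unfold coverKer
  rw [tsum_eq_single 0]
  · simp [poissonWeight, poissonTail]
  · intro k hk
    obtain ⟨k, rfl⟩ := Nat.exists_eq_succ_of_ne_zero hk
    have : poissonTail (k + 1) 0 = 0 := by
      simp [poissonTail, Finset.sum_range_succ', poissonWeight]
    simp [this]

/-- `∑_k (q^k/k!) (q^{k+d}/(k+d)!)`, the modified Bessel function `I_d(2q)`. -/
noncomputable def besselSum (d : ℕ) (q : ℝ) : ℝ :=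
  ∑' k : ℕ, (q ^ k / (k.factorial : ℝ)) * (q ^ (d + k) / ((d + k).factorial : ℝ))

lemma summable_besselSum (d : ℕ) {q : ℝ} (hq : 0 ≤ q) :
    Summable fun k : ℕ => (q ^ k / (k.factorial : ℝ)) *
      (q ^ (d + k) / ((d + k).factorial : ℝ)) := by
  refine Summable.of_nonneg_of_le (fun k => by positivity) (fun k => ?_)
    ((hasSum_pow_div_factorial q).summable.mul_right (Real.exp q))
  exact mul_le_mul_of_nonneg_left
    (le_hasSum (hasSum_pow_div_factorial q) (d + k) fun _ _ => by positivity) (by positivity)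

lemma besselSum_nonneg (d : ℕ) {q : ℝ} (hq : 0 ≤ q) : 0 ≤ besselSum d q :=
  tsum_nonneg fun k => by positivity

lemma besselSum_le_zero (d : ℕ) {q : ℝ} (hq : 0 ≤ q) : besselSum d q ≤ besselSum 0 q := by
  set b : ℕ → ℝ := fun k => q ^ k / (k.factorial : ℝ)
  have hS : Summable fun k => b k * b k := by simpa [b] using summable_besselSum 0 hq
  have h0 : besselSum 0 q = ∑' k, b k * b k := by simp [besselSum, b]
  have hSd : Summable fun k => b (d + k) * b (d + k) := by
    simpa only [add_comm d] using (summable_nat_add_iff d).2 hS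
  have hd : ∑' k, b (d + k) * b (d + k) ≤ ∑' k, b k * b k := by
    have := hS.sum_add_tsum_nat_add d
    have h2 : 0 ≤ ∑ i ∈ Finset.range d, b i * b i :=
      Finset.sum_nonneg fun i _ => mul_self_nonneg _
    simp only [add_comm d]
    linarith
  have hle : besselSum d q ≤ ∑' k, (b k * b k + b (d + k) * b (d + k)) / 2 := by
    refine (summable_besselSum d hq).tsum_le_tsum (fun k => ?_) ((hS.add hSd).div_const 2)
    change b k * b (d + k) ≤ _
    nlinarith [sq_nonneg (b k - b (d + k))]
  rw [tsum_div_const, hS.tsum_add hSd] at hle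
  rw [h0]
  linarith

lemma tsum_poissonWeight_mul_self (X Y : ℝ) :
    ∑' k, poissonWeight k (X ^ 2) * poissonWeight k (Y ^ 2) =
      Real.exp (-(X ^ 2 + Y ^ 2)) * besselSum 0 (X * Y) := by
  unfold besselSum
  rw [← tsum_mul_left]
  refine tsum_congr fun k => ?_
  rw [neg_add, Real.exp_add]
  simp only [poissonWeight, zero_add]
  rw [mul_pow, pow_right_comm X, pow_right_comm Y]
  ring

lemma mul_tsum_poissonWeight_succ_mul (X Y : ℝ) :
    Y * ∑' k, poissonWeight (k + 1) (X ^ 2) * poissonWeight k (Y ^ 2) =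
      X * (Real.exp (-(X ^ 2 + Y ^ 2)) * besselSum 1 (X * Y)) := by
  unfold besselSum
  rw [← tsum_mul_left, ← tsum_mul_left, ← tsum_mul_left]
  refine tsum_congr fun k => ?_
  rw [neg_add, Real.exp_add, add_comm 1 k]
  simp only [poissonWeight]
  rw [mul_pow, mul_pow, ← pow_mul, ← pow_mul]
  ring

lemma hasDerivAt_coverKer (x y α β t : ℝ) :
    HasDerivAt (fun t => coverKer (x + α * t) (y + β * t))
      (2 * (x + α * t) * Real.exp (-((x + α * t) ^ 2 + (y + β * t) ^ 2)) *
        (β * besselSum 1 ((x + α * t) * (y + β * t)) -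
          α * besselSum 0 ((x + α * t) * (y + β * t)))) t := by
  set f' : ℕ → ℝ → ℝ := fun k t =>
    ((poissonWeightPred k ((x + α * t) ^ 2) - poissonWeight k ((x + α * t) ^ 2)) *
      (2 * (x + α * t) * α)) * poissonTail k ((y + β * t) ^ 2) +
    poissonWeight k ((x + α * t) ^ 2) *
      (poissonWeightPred k ((y + β * t) ^ 2) * (2 * (y + β * t) * β)) with hf'
  have hterm : ∀ k t, HasDerivAt (fun t => poissonWeight k ((x + α * t) ^ 2) *
      poissonTail k ((y + β * t) ^ 2)) (f' k t) t := by
    intro k t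
    have hx : HasDerivAt (fun t => (x + α * t) ^ 2) (2 * (x + α * t) * α) t := by
      simpa using (((hasDerivAt_id t).const_mul α).const_add x).fun_pow 2
    have hy : HasDerivAt (fun t => (y + β * t) ^ 2) (2 * (y + β * t) * β) t := by
      simpa using (((hasDerivAt_id t).const_mul β).const_add y).fun_pow 2
    exact ((hasDerivAt_poissonWeight k _).comp t hx).mul
      ((hasDerivAt_poissonTail k _).comp t hy)
  set R : ℝ := |x| + |y| + (|α| + |β|) * (|t| + 1)
  have hR : ∀ s ∈ Metric.ball t 1, |x + α * s| ≤ R ∧ |y + β * s| ≤ R := by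
    intro s hs
    have hs1 : |s| ≤ |t| + 1 := by
      rw [Metric.mem_ball, Real.dist_eq] at hs
      have := abs_add_le (s - t) t
      rw [sub_add_cancel] at this
      linarith
    have h1 : |α| * |s| ≤ |α| * (|t| + 1) := by gcongr
    have h2 : |β| * |s| ≤ |β| * (|t| + 1) := by gcongr
    have h3 : 0 ≤ |α| * |s| := by positivity
    have h4 : 0 ≤ |β| * |s| := by positivity
    have h5 := abs_add_le x (α * s)
    have h6 := abs_add_le y (β * s)
    rw [abs_mul] at h5 h6
    have hx0 := abs_nonneg x
    have hy0 := abs_nonneg y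
    have hRe : R = |x| + |y| + |α| * (|t| + 1) + |β| * (|t| + 1) := by simp only [R]; ring
    constructor <;> linarith
  set e : ℕ → ℝ := fun k => (R ^ 2) ^ k / (k.factorial : ℝ)
  set e1 : ℕ → ℝ := fun k => match k with
    | 0 => 0
    | k + 1 => e k
  have he : Summable e := Real.summable_pow_div_factorial _
  have he1 : Summable e1 := (summable_nat_add_iff 1).1 he
  have hR0 : 0 ≤ R := by positivity
  have hu : Summable fun k => (e1 k + e k) * (2 * R * |α|) + e k * (2 * R * |β|) :=
    ((he1.add he).mul_right _).add (he.mul_right _)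
  have hbound : ∀ k s, s ∈ Metric.ball t 1 →
      ‖f' k s‖ ≤ (e1 k + e k) * (2 * R * |α|) + e k * (2 * R * |β|) := by
    intro k s hs
    obtain ⟨h1, h2⟩ := hR s hs
    have hsq : (x + α * s) ^ 2 ≤ R ^ 2 := sq_le_sq.2 (by rwa [abs_of_nonneg hR0])
    have w0 := poissonWeight_nonneg k (sq_nonneg (x + α * s))
    have w1 : poissonWeight k ((x + α * s) ^ 2) ≤ e k := poissonWeight_le k (sq_nonneg _) hsq
    have p0 := poissonWeightPred_nonneg k (sq_nonneg (x + α * s))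
    have p1 : poissonWeightPred k ((x + α * s) ^ 2) ≤ e1 k := by
      cases k with
      | zero => exact le_rfl
      | succ k => exact poissonWeight_le k (sq_nonneg _) hsq
    have t0 := poissonTail_nonneg k (sq_nonneg (y + β * s))
    have t1 := poissonTail_le_one k (sq_nonneg (y + β * s))
    have q0 := poissonWeightPred_nonneg k (sq_nonneg (y + β * s))
    have q1 := poissonWeightPred_le_one k (sq_nonneg (y + β * s))
    have hA : |poissonWeightPred k ((x + α * s) ^ 2) - poissonWeight k ((x + α * s) ^ 2)| ≤
        e1 k + e k := by rw [abs_le]; constructor <;> linarith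
    rw [Real.norm_eq_abs]
    refine (abs_add_le _ _).trans (add_le_add ?_ ?_)
    · rw [abs_mul, abs_mul, abs_mul, abs_mul, abs_of_nonneg t0, abs_two]
      have : 0 ≤ e1 k + e k := (abs_nonneg _).trans hA
      calc _ ≤ (e1 k + e k) * (2 * R * |α|) * 1 := by gcongr
        _ = _ := mul_one _
    · rw [abs_mul, abs_mul, abs_mul, abs_mul, abs_of_nonneg w0, abs_of_nonneg q0, abs_two]
      calc _ ≤ e k * (1 * (2 * R * |β|)) := by
            have : 0 ≤ e k := w0.trans w1
            gcongr
        _ = _ := by ring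
  have hmain := hasDerivAt_tsum_of_isPreconnected hu Metric.isOpen_ball
    (convex_ball t 1).isPreconnected (fun k s _ => hterm k s) hbound
    (Metric.mem_ball_self zero_lt_one) (summable_coverKer _ _) (Metric.mem_ball_self zero_lt_one)
  refine hmain.congr_deriv ?_
  set X := x + α * t
  set Y := y + β * t
  have hX := sq_nonneg X
  have hY := sq_nonneg Y
  have s1 : Summable fun k => poissonWeight k (X ^ 2) * poissonWeight k (Y ^ 2) :=
    summable_weight_mul hX (fun k => poissonWeight_nonneg k hY) fun k => poissonWeight_le_one k hY
  have s2 : Summable fun k => poissonWeight k (X ^ 2) * poissonWeightPred k (Y ^ 2) :=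
    summable_weight_mul hX (fun k => poissonWeightPred_nonneg k hY)
      fun k => poissonWeightPred_le_one k hY
  have s3 := summable_coverKer X Y
  have s4 : Summable fun k => poissonWeight k (X ^ 2) * poissonTail (k + 1) (Y ^ 2) :=
    summable_weight_mul hX (fun k => poissonTail_nonneg _ hY) fun k => poissonTail_le_one _ hY
  have s5 : Summable fun k => poissonWeightPred k (X ^ 2) * poissonTail k (Y ^ 2) :=
    (summable_nat_add_iff 1).1 s4
  have v2 : ∑' k, poissonWeight k (X ^ 2) * poissonWeightPred k (Y ^ 2) =
      ∑' k, poissonWeight (k + 1) (X ^ 2) * poissonWeight k (Y ^ 2) := by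
    rw [s2.tsum_eq_zero_add]; simp [poissonWeightPred]
  have v5 : ∑' k, poissonWeightPred k (X ^ 2) * poissonTail k (Y ^ 2) =
      ∑' k, poissonWeight k (X ^ 2) * poissonTail (k + 1) (Y ^ 2) := by
    rw [s5.tsum_eq_zero_add]; simp [poissonWeightPred]
  have v4 : ∑' k, poissonWeight k (X ^ 2) * poissonTail (k + 1) (Y ^ 2) =
      ∑' k, poissonWeight k (X ^ 2) * poissonTail k (Y ^ 2) -
      ∑' k, poissonWeight k (X ^ 2) * poissonWeight k (Y ^ 2) := by
    rw [← s3.tsum_sub s1]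
    exact tsum_congr fun k => by rw [poissonTail_succ]; ring
  have hsplit : ∑' k, f' k t =
      (2 * X * α) * (∑' k, poissonWeightPred k (X ^ 2) * poissonTail k (Y ^ 2) -
        ∑' k, poissonWeight k (X ^ 2) * poissonTail k (Y ^ 2)) +
      (2 * Y * β) * ∑' k, poissonWeight k (X ^ 2) * poissonWeightPred k (Y ^ 2) := by
    rw [← s5.tsum_sub s3, ← tsum_mul_left, ← tsum_mul_left,
      ← ((s5.sub s3).mul_left _).tsum_add (s2.mul_left _)]
    exact tsum_congr fun k => by simp only [hf']; ring
  rw [hsplit, v5, v4, v2, tsum_poissonWeight_mul_self]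
  have := mul_tsum_poissonWeight_succ_mul X Y
  linear_combination (2 * β) * this

lemma besselSum_zero_le {q : ℝ} (hq : 1 ≤ q) : besselSum 0 q ≤ 4 * besselSum 1 q := by
  have hq0 : 0 < q := by linarith
  set b : ℕ → ℝ := fun k => q ^ k / (k.factorial : ℝ) with hb
  have hbpos : ∀ k, 0 < b k := fun k => by positivity
  have hbsucc : ∀ k : ℕ, b (k + 1) * (k + 1) = b k * q := by
    intro k
    simp only [hb, Nat.factorial_succ, Nat.cast_mul, Nat.cast_add, Nat.cast_one]
    field_simp
    ring
  set p : ℕ → ℝ := fun k => match k with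
    | 0 => 0
    | k + 1 => b k * b (k + 1) with hp
  have h1 : besselSum 1 q = ∑' k, b k * b (k + 1) := by simp [besselSum, hb, add_comm]
  have h0 : besselSum 0 q = ∑' k, b k * b k := by simp [besselSum, hb]
  have hS1 : Summable fun k => b k * b (k + 1) := by
    simpa [hb, add_comm] using summable_besselSum 1 hq0.le
  have hS0 : Summable fun k => b k * b k := by simpa [hb] using summable_besselSum 0 hq0.le
  have hSp : Summable p := (summable_nat_add_iff 1).1 hS1
  have hpt : ∑' k, p k = ∑' k, b k * b (k + 1) := by
    rw [hSp.tsum_eq_zero_add]; simp [hp]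
  have hterm : ∀ k, b k * b k ≤ 2 * (p k + b k * b (k + 1)) := by
    intro k
    cases k with
    | zero =>
      have := hbsucc 0
      simp only [Nat.cast_zero, zero_add, mul_one] at this
      simp only [hp, zero_add, this]
      nlinarith [hbpos 0, mul_pos (hbpos 0) (hbpos 0)]
    | succ k =>
      have e1 := hbsucc k
      have e2 := hbsucc (k + 1)
      push_cast at e2
      simp only [hp]
      have hk : (0 : ℝ) ≤ k := k.cast_nonneg
      have hB := hbpos (k + 1)
      have key : b (k + 1) ≤ 2 * (b k + b (k + 1 + 1)) := by
        have f1 : b k = b (k + 1) * (k + 1) / q := by field_simp; linarith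
        have f2 : b (k + 1 + 1) = b (k + 1) * q / (k + 2) := by
          field_simp; linear_combination e2
        rw [f1, f2]
        rcases le_total q (2 * (k + 1)) with h | h
        · have : b (k + 1) ≤ 2 * (b (k + 1) * (k + 1) / q) := by
            rw [mul_div_assoc', le_div_iff₀ hq0]; nlinarith
          have : 0 ≤ b (k + 1) * q / (k + 2) := by positivity
          linarith
        · have : b (k + 1) ≤ 2 * (b (k + 1) * q / (k + 2)) := by
            rw [mul_div_assoc', le_div_iff₀ (by positivity)]; nlinarith
          have : 0 ≤ b (k + 1) * (k + 1) / q := by positivity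
          linarith
      nlinarith
  have := hS0.tsum_le_tsum hterm ((hSp.add hS1).mul_left 2)
  rw [tsum_mul_left, hSp.tsum_add hS1, hpt] at this
  rw [h0, h1]
  linarith

lemma hasDerivAt_coverKer_left (x y : ℝ) :
    HasDerivAt (fun x => coverKer x y)
      (-(2 * x * Real.exp (-(x ^ 2 + y ^ 2)) * besselSum 0 (x * y))) x := by
  have h := hasDerivAt_coverKer 0 y 1 0 x
  simp only [zero_add, one_mul, zero_mul, add_zero] at h
  exact h.congr_deriv (by ring)

lemma hasDerivAt_coverKer_right (x y : ℝ) :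
    HasDerivAt (fun y => coverKer x y)
      (2 * x * Real.exp (-(x ^ 2 + y ^ 2)) * besselSum 1 (x * y)) y := by
  have h := hasDerivAt_coverKer x 0 0 1 y
  simp only [zero_add, one_mul, zero_mul, add_zero] at h
  exact h.congr_deriv (by ring)

lemma coverKer_antitone_left {y : ℝ} (hy : 0 ≤ y) :
    AntitoneOn (fun x => coverKer x y) (Ici 0) := by
  refine antitoneOn_of_deriv_nonpos (convex_Ici 0)
    (fun x _ => (hasDerivAt_coverKer_left x y).continuousAt.continuousWithinAt)
    (fun x _ => (hasDerivAt_coverKer_left x y).differentiableAt.differentiableWithinAt) ?_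
  intro x hx
  rw [interior_Ici, mem_Ioi] at hx
  rw [(hasDerivAt_coverKer_left x y).deriv]
  have := besselSum_nonneg 0 (mul_nonneg hx.le hy)
  have : 0 ≤ 2 * x * Real.exp (-(x ^ 2 + y ^ 2)) * besselSum 0 (x * y) := by positivity
  linarith

lemma coverKer_monotone_right {x : ℝ} (hx : 0 ≤ x) :
    MonotoneOn (fun y => coverKer x y) (Ici 0) := by
  refine monotoneOn_of_deriv_nonneg (convex_Ici 0)
    (fun y _ => (hasDerivAt_coverKer_right x y).continuousAt.continuousWithinAt)
    (fun y _ => (hasDerivAt_coverKer_right x y).differentiableAt.differentiableWithinAt) ?_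
  intro y hy
  rw [interior_Ici, mem_Ioi] at hy
  rw [(hasDerivAt_coverKer_right x y).deriv]
  have := besselSum_nonneg 1 (mul_nonneg hx hy.le)
  positivity

lemma coverKer_add_add_le {x y t : ℝ} (hx : 0 ≤ x) (hy : 0 ≤ y) (ht : 0 ≤ t) :
    coverKer (x + t) (y + t) ≤ coverKer x y := by
  have hd := fun t => hasDerivAt_coverKer x y 1 1 t
  have h : AntitoneOn (fun t => coverKer (x + 1 * t) (y + 1 * t)) (Ici 0) := by
    refine antitoneOn_of_deriv_nonpos (convex_Ici 0)
      (fun t _ => (hd t).continuousAt.continuousWithinAt)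
      (fun t _ => (hd t).differentiableAt.differentiableWithinAt) ?_
    intro t ht
    rw [interior_Ici, mem_Ioi] at ht
    rw [(hd t).deriv]
    simp only [one_mul]
    have h1 := besselSum_le_zero 1 (q := (x + t) * (y + t)) (by positivity)
    refine mul_nonpos_of_nonneg_of_nonpos (by positivity) (by linarith)
  simpa using h (mem_Ici.2 le_rfl) (mem_Ici.2 ht) ht

lemma hasSum_pow_mul_poissonWeight (μ r : ℝ) :
    HasSum (fun j => poissonWeight j r * μ ^ j) (Real.exp (μ * r - r)) := by
  have h := (hasSum_pow_div_factorial (μ * r)).mul_left (Real.exp (-r))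
  rw [← Real.exp_add, neg_add_eq_sub] at h
  have he : (fun j => poissonWeight j r * μ ^ j) = fun j : ℕ =>
      Real.exp (-r) * ((μ * r) ^ j / (j.factorial : ℝ)) := by
    ext j; simp only [poissonWeight, mul_pow]; ring
  rwa [he]

lemma poissonTail_le {lam r : ℝ} (hl : 0 < lam) (hl1 : lam ≤ 1) (hr : 0 ≤ r) (k : ℕ) :
    poissonTail k r ≤ lam ^ k * Real.exp (r / lam - r) := by
  have h := (hasSum_pow_mul_poissonWeight lam⁻¹ r).mul_left (lam ^ k)
  rw [← div_eq_inv_mul] at h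
  have hnn : ∀ j, 0 ≤ lam ^ k * (poissonWeight j r * lam⁻¹ ^ j) := fun j => by
    have := poissonWeight_nonneg j hr
    positivity
  rw [← (hasSum_poissonTail k r).tsum_eq]
  refine ((hasSum_poissonTail k r).summable.tsum_le_tsum (fun d => ?_)
    ((summable_nat_add_iff k).2 h.summable)).trans ?_
  · rw [pow_add, mul_comm (lam⁻¹ ^ d)]
    have h1 : 1 ≤ lam⁻¹ ^ d := one_le_pow₀ ((one_le_inv₀ hl).2 hl1)
    have h2 : lam ^ k * lam⁻¹ ^ k = 1 := by rw [← mul_pow, mul_inv_cancel₀ hl.ne', one_pow]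
    calc poissonWeight (d + k) r ≤ poissonWeight (d + k) r * lam⁻¹ ^ d :=
          le_mul_of_one_le_right (poissonWeight_nonneg _ hr) h1
      _ = _ := by linear_combination (-(poissonWeight (d + k) r * lam⁻¹ ^ d)) * h2
  · rw [← h.tsum_eq, ← h.summable.sum_add_tsum_nat_add k]
    have := Finset.sum_nonneg fun j (_ : j ∈ Finset.range k) => hnn j
    linarith

lemma one_sub_poissonTail_le {lam r : ℝ} (hl1 : 1 ≤ lam) (hr : 0 ≤ r) (k : ℕ) :
    1 - poissonTail k r ≤ lam ^ k * Real.exp (r / lam - r) := by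
  have hl : 0 < lam := by linarith
  have h := (hasSum_pow_mul_poissonWeight lam⁻¹ r).mul_left (lam ^ k)
  rw [← div_eq_inv_mul] at h
  have hnn : ∀ j, 0 ≤ lam ^ k * (poissonWeight j r * lam⁻¹ ^ j) := fun j => by
    have := poissonWeight_nonneg j hr
    positivity
  refine le_trans ?_ (sum_le_hasSum (Finset.range k) (fun j _ => hnn j) h)
  simp only [poissonTail, sub_sub_cancel]
  refine Finset.sum_le_sum fun j hj => ?_
  have hjk := (Finset.mem_range.1 hj).le
  have h2 : 1 ≤ lam ^ k * lam⁻¹ ^ j := by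
    rw [inv_pow, ← div_eq_mul_inv, one_le_div (by positivity)]
    exact pow_le_pow_right₀ hl1 hjk
  nlinarith [poissonWeight_nonneg j hr]

lemma coverKer_le_exp {x y : ℝ} (hy : 0 ≤ y) (hx : 0 < x) (hyx : y ≤ x) :
    coverKer x y ≤ Real.exp (-(x - y) ^ 2) := by
  rcases hy.eq_or_lt with rfl | hy
  · rw [coverKer_zero_right, sub_zero]
  have h := (hasSum_pow_mul_poissonWeight (y / x) (x ^ 2)).mul_right
    (Real.exp (y ^ 2 / (y / x) - y ^ 2))
  rw [← Real.exp_add] at h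
  have he : y / x * x ^ 2 - x ^ 2 + (y ^ 2 / (y / x) - y ^ 2) = -(x - y) ^ 2 := by
    field_simp; ring
  rw [he] at h
  rw [← h.tsum_eq]
  refine (summable_coverKer x y).tsum_le_tsum (fun k => ?_) h.summable
  rw [mul_assoc]
  exact mul_le_mul_of_nonneg_left
    (poissonTail_le (by positivity) ((div_le_one hx).2 hyx) (sq_nonneg y) k)
    (poissonWeight_nonneg k (sq_nonneg x))

lemma one_sub_coverKer_le_exp {x y : ℝ} (hx : 0 < x) (hxy : x ≤ y) :
    1 - coverKer x y ≤ Real.exp (-(x - y) ^ 2) := by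
  have hy : 0 < y := by linarith
  have h := (hasSum_pow_mul_poissonWeight (y / x) (x ^ 2)).mul_right
    (Real.exp (y ^ 2 / (y / x) - y ^ 2))
  rw [← Real.exp_add] at h
  have he : y / x * x ^ 2 - x ^ 2 + (y ^ 2 / (y / x) - y ^ 2) = -(x - y) ^ 2 := by
    field_simp; ring
  rw [he] at h
  have hw := hasSum_poissonWeight (x ^ 2)
  rw [← h.tsum_eq, ← hw.tsum_eq, coverKer, ← hw.summable.tsum_sub (summable_coverKer x y)]
  refine (hw.summable.sub (summable_coverKer x y)).tsum_le_tsum (fun k => ?_) h.summable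
  rw [mul_assoc, ← mul_one_sub]
  exact mul_le_mul_of_nonneg_left
    (one_sub_poissonTail_le ((one_le_div hx).2 hxy) (sq_nonneg y) k)
    (poissonWeight_nonneg k (sq_nonneg x))

lemma coverKer_le_mul_besselSum {x y : ℝ} (hx : 0 < x) (hy : 0 ≤ y) (hyx : y ≤ x - 1) :
    coverKer x y ≤ x * (Real.exp (-(x ^ 2 + y ^ 2)) * besselSum 0 (x * y)) := by
  set f : ℕ × ℕ → ℝ := fun p =>
    poissonWeight p.1 (x ^ 2) * poissonWeight (p.2 + p.1) (y ^ 2) with hf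
  have hf0 : 0 ≤ f := fun p => mul_nonneg (poissonWeight_nonneg _ (sq_nonneg x))
    (poissonWeight_nonneg _ (sq_nonneg y))
  have hin : ∀ k, HasSum (fun d => f (k, d))
      (poissonWeight k (x ^ 2) * poissonTail k (y ^ 2)) := fun k =>
    (hasSum_poissonTail k (y ^ 2)).mul_left _
  have hsum : Summable f := by
    rw [summable_prod_of_nonneg hf0]
    refine ⟨fun k => (hin k).summable, ?_⟩
    simp_rw [fun k => (hin k).tsum_eq]
    exact summable_coverKer x y
  have hG : coverKer x y = ∑' d, ∑' k, f (k, d) := by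
    refine Eq.trans ?_ (Summable.tsum_comm (f := fun k d => f (k, d)) hsum).symm
    exact tsum_congr fun k => (hin k).tsum_eq.symm
  have hfd : ∀ d, ∑' k, f (k, d) =
      (y / x) ^ d * (Real.exp (-(x ^ 2 + y ^ 2)) * besselSum d (x * y)) := by
    intro d
    unfold besselSum
    rw [← tsum_mul_left, ← tsum_mul_left]
    refine tsum_congr fun k => ?_
    have hxk : x ^ (d + k) = x ^ d * x ^ k := pow_add _ _ _
    simp only [hf, poissonWeight]
    rw [neg_add, Real.exp_add, mul_pow, mul_pow, div_pow, hxk, ← pow_mul, ← pow_mul]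
    field_simp
    ring
  have hr : y / x < 1 := (div_lt_one hx).2 (by linarith)
  have hr0 : 0 ≤ y / x := by positivity
  have hE : 0 ≤ Real.exp (-(x ^ 2 + y ^ 2)) * besselSum 0 (x * y) :=
    mul_nonneg (Real.exp_nonneg _) (besselSum_nonneg 0 (by positivity))
  have hgeo := (hasSum_geometric_of_lt_one hr0 hr).mul_right
    (Real.exp (-(x ^ 2 + y ^ 2)) * besselSum 0 (x * y))
  have hsd : Summable fun d => ∑' k, f (k, d) := hsum.prod_symm.prod
  rw [hG]
  refine (hsd.tsum_le_tsum (fun d => ?_) hgeo.summable).trans (hgeo.tsum_eq.trans_le ?_)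
  · rw [hfd]
    have := besselSum_le_zero d (q := x * y) (by positivity)
    gcongr
  · refine mul_le_mul_of_nonneg_right ?_ hE
    rw [inv_le_comm₀ (by linarith) hx, ← one_div, le_sub_iff_add_le, ← add_div, div_le_one hx]
    linarith

lemma coverKer_growth_of_inv_le {x y : ℝ} (hx : 0 < x) (hy : 1 / x ≤ y) (hyx : y + 1 ≤ x - 1) :
    3 / 2 * coverKer x y ≤ coverKer x (y + 1) := by
  have hy0 : 0 < y := lt_of_lt_of_le (by positivity) hy
  have hderiv : ∀ t ∈ interior (Icc y (y + 1)), coverKer x y / 2 ≤ deriv (fun t => coverKer x t) t := by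
    intro t ht
    rw [interior_Icc, mem_Ioo] at ht
    rw [(hasDerivAt_coverKer_right x t).deriv]
    have ht0 : 0 ≤ t := by linarith
    have h1 : 1 ≤ x * t := by
      rw [div_le_iff₀ hx] at hy
      nlinarith
    have h2 := coverKer_le_mul_besselSum hx ht0 (by linarith)
    have h3 := besselSum_zero_le h1
    have h4 : coverKer x y ≤ coverKer x t :=
      coverKer_monotone_right hx.le (mem_Ici.2 hy0.le) (mem_Ici.2 ht0) ht.1.le
    have h5 := mul_le_mul_of_nonneg_left h3
      (mul_nonneg hx.le (Real.exp_nonneg (-(x ^ 2 + t ^ 2))))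
    nlinarith
  have := (convex_Icc y (y + 1)).mul_sub_le_image_sub_of_le_deriv
    (fun t _ => (hasDerivAt_coverKer_right x t).continuousAt.continuousWithinAt)
    (fun t _ => (hasDerivAt_coverKer_right x t).differentiableAt.differentiableWithinAt)
    hderiv y (left_mem_Icc.2 (by linarith)) (y + 1) (right_mem_Icc.2 (by linarith)) (by linarith)
  linarith

lemma coverKer_growth {x y : ℝ} (hx : 3 ≤ x) (hy : 0 ≤ y) (hyx : y ≤ x - 2) :
    3 / 2 * coverKer x y ≤ coverKer x (y + 2) := by
  have hx0 : 0 < x := by linarith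
  have h3 : 1 / x ≤ 1 / 3 := one_div_le_one_div_of_le (by norm_num) hx
  have hi : 0 < 1 / x := by positivity
  set z := max y (1 / x) with hz
  have hz1 : y ≤ z := le_max_left _ _
  have hz2 : z ≤ y + 1 := max_le (by linarith) (by linarith)
  have hz3 : z + 1 ≤ x - 1 := by
    have : z ≤ x - 2 := max_le hyx (by linarith)
    linarith
  have h := coverKer_growth_of_inv_le hx0 (le_max_right y (1 / x)) hz3
  have hm := coverKer_monotone_right hx0.le
  have h1 : coverKer x y ≤ coverKer x z := hm (mem_Ici.2 hy) (mem_Ici.2 (hy.trans hz1)) hz1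
  have h2 : coverKer x (z + 1) ≤ coverKer x (y + 2) :=
    hm (mem_Ici.2 (by linarith)) (mem_Ici.2 (by linarith)) (by linarith)
  linarith

lemma coverKer_lt_one {x : ℝ} (hx : 0 < x) (y : ℝ) : coverKer x y < 1 := by
  rw [← (hasSum_poissonWeight (x ^ 2)).tsum_eq]
  refine (summable_coverKer x y).tsum_lt_tsum (i := 1)
    (fun k => mul_le_of_le_one_right (poissonWeight_nonneg k (sq_nonneg x))
      (poissonTail_le_one k (sq_nonneg y))) ?_ (hasSum_poissonWeight _).summable
  refine mul_lt_of_lt_one_right ?_ ?_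
  · unfold poissonWeight; positivity
  · have : 0 < poissonWeight 0 (y ^ 2) := by unfold poissonWeight; positivity
    simp [poissonTail, this]

/-- The cumulative distribution function `y ↦ Ḡ(y, x - y)` on `[0, ∞)`, extended by `0`. -/
noncomputable def coverCdf (x y : ℝ) : ℝ := if y < 0 then 0 else coverKer (max x 0) y

lemma coverCdf_of_neg (x : ℝ) {y : ℝ} (hy : y < 0) : coverCdf x y = 0 := if_pos hy

lemma coverCdf_of_nonneg (x : ℝ) {y : ℝ} (hy : 0 ≤ y) : coverCdf x y = coverKer (max x 0) y :=
  if_neg hy.not_gt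

lemma coverCdf_nonneg (x y : ℝ) : 0 ≤ coverCdf x y := by
  unfold coverCdf; split_ifs
  exacts [le_rfl, coverKer_nonneg _ _]

lemma coverCdf_le_one (x y : ℝ) : coverCdf x y ≤ 1 := by
  unfold coverCdf; split_ifs
  exacts [zero_le_one, coverKer_le_one _ _]

lemma coverCdf_of_nonpos {x y : ℝ} (hx : x ≤ 0) (hy : 0 ≤ y) : coverCdf x y = 1 := by
  rw [coverCdf_of_nonneg x hy, max_eq_right hx, coverKer_zero_left]

lemma coverCdf_monotone (x : ℝ) : Monotone (coverCdf x) := by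
  intro y z hyz
  rcases lt_or_ge y 0 with hy | hy
  · rw [coverCdf_of_neg x hy]; exact coverCdf_nonneg _ _
  · rw [coverCdf_of_nonneg x hy, coverCdf_of_nonneg x (hy.trans hyz)]
    exact coverKer_monotone_right (le_max_right _ _) (mem_Ici.2 hy) (mem_Ici.2 (hy.trans hyz)) hyz

lemma coverCdf_antitone_left (y : ℝ) : Antitone fun x => coverCdf x y := by
  intro x z hxz
  rcases lt_or_ge y 0 with hy | hy
  · simp [coverCdf_of_neg _ hy]
  · simp only [coverCdf_of_nonneg _ hy]
    exact coverKer_antitone_left hy (mem_Ici.2 (le_max_right _ _)) (mem_Ici.2 (le_max_right _ _))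
      (max_le_max_right 0 hxz)

lemma coverCdf_continuous_left (y : ℝ) : Continuous fun x => coverCdf x y := by
  rcases lt_or_ge y 0 with hy | hy
  · simp only [coverCdf_of_neg _ hy]; exact continuous_const
  · simp only [coverCdf_of_nonneg _ hy]
    have : Continuous fun x => coverKer x y :=
      continuous_iff_continuousAt.2 fun x => (hasDerivAt_coverKer_left x y).continuousAt
    exact this.comp (continuous_id.max continuous_const)

lemma coverCdf_rightContinuous (x y : ℝ) : ContinuousWithinAt (coverCdf x) (Ici y) y := by
  rcases lt_or_ge y 0 with hy | hy
  · have : coverCdf x =ᶠ[nhds y] fun _ => 0 :=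
      eventually_of_mem (Iio_mem_nhds hy) fun z hz => coverCdf_of_neg x hz
    exact (continuousAt_const.congr this.symm).continuousWithinAt
  · refine ((hasDerivAt_coverKer_right (max x 0) y).continuousAt.continuousWithinAt).congr
      (fun z hz => coverCdf_of_nonneg x (hy.trans hz)) (coverCdf_of_nonneg x hy)

lemma coverCdf_add_le {M : ℝ} (hM : 0 ≤ M) (x : ℝ) {y : ℝ} (hy : 0 ≤ y) :
    coverCdf x (y + M) ≤ coverCdf (x - M) y := by
  rcases le_total x M with h | h
  · rw [coverCdf_of_nonpos (sub_nonpos.2 h) hy]; exact coverCdf_le_one _ _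
  · have hx := hM.trans h
    rw [coverCdf_of_nonneg _ hy, coverCdf_of_nonneg _ (add_nonneg hy hM), max_eq_left hx,
      max_eq_left (sub_nonneg.2 h)]
    simpa using coverKer_add_add_le (sub_nonneg.2 h) hy hM

lemma one_sub_exp_le_coverCdf {x a : ℝ} (ha : 0 ≤ a) (hxa : 0 ≤ x + a) :
    1 - Real.exp (-a ^ 2) ≤ coverCdf x (x + a) := by
  rcases le_or_gt x 0 with hx | hx
  · rw [coverCdf_of_nonpos hx hxa]
    linarith [Real.exp_nonneg (-a ^ 2)]
  · rw [coverCdf_of_nonneg x hxa, max_eq_left hx.le]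
    have := one_sub_coverKer_le_exp hx (le_add_of_nonneg_right ha)
    rw [show x - (x + a) = -a by ring, neg_sq] at this
    linarith

lemma coverCdf_sub_le_exp {x b : ℝ} (hb : 0 ≤ b) : coverCdf x (x - b) ≤ Real.exp (-b ^ 2) := by
  rcases lt_or_ge (x - b) 0 with h | h
  · rw [coverCdf_of_neg x h]; exact Real.exp_nonneg _
  rcases (hb.trans (sub_nonneg.1 h)).eq_or_lt with hx | hx
  · have : b = 0 := by linarith
    subst this
    simpa using coverCdf_le_one x (x - 0)
  · rw [coverCdf_of_nonneg x h, max_eq_left hx.le]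
    simpa using coverKer_le_exp h hx (sub_le_self x hb)

lemma coverCdf_tendsto_atBot (x : ℝ) : Tendsto (coverCdf x) atBot (nhds 0) := by
  refine tendsto_const_nhds.congr' ?_
  filter_upwards [eventually_lt_atBot 0] with y hy
  exact (coverCdf_of_neg x hy).symm

lemma coverCdf_tendsto_atTop (x : ℝ) : Tendsto (coverCdf x) atTop (nhds 1) := by
  have h1 : Tendsto (fun y : ℝ => y - x) atTop atTop := tendsto_atTop_add_const_right _ (-x) tendsto_id
  have h2 : Tendsto (fun y : ℝ => 1 - Real.exp (-(y - x) ^ 2)) atTop (nhds 1) := by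
    have h3 := (tendsto_pow_atTop (α := ℝ) two_ne_zero).comp h1
    have := (Real.tendsto_exp_neg_atTop_nhds_zero.comp h3).const_sub 1
    simpa [Function.comp_def] using this
  refine tendsto_of_tendsto_of_tendsto_of_le_of_le' h2 tendsto_const_nhds ?_
    (Eventually.of_forall fun y => coverCdf_le_one x y)
  filter_upwards [eventually_ge_atTop x, eventually_ge_atTop 0] with y hy hy0
  have := one_sub_exp_le_coverCdf (x := x) (a := y - x) (by linarith) (by linarith)
  rwa [add_sub_cancel] at this

/-- Geometric growth of the kernel below the scale `x + 3`. -/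
lemma exists_coverCdf_growth : ∃ c m : ℝ, 0 < c ∧ c ≤ 1 / 2 ∧ 2 ≤ m ∧
    ∀ x, 3 ≤ x → ∀ y, y ≤ x + 3 → (1 + c) * coverCdf x y ≤ coverCdf x (y + m) := by
  set η := coverKer 3 6
  have hη : η < 1 := coverKer_lt_one (by norm_num) 6
  have hη0 : 0 ≤ η := coverKer_nonneg _ _
  set c := (1 - η) / 2 with hc
  have hc0 : 0 < c := by rw [hc]; linarith
  have hlim : Tendsto (fun m : ℝ => Real.exp (-m ^ 2)) atTop (nhds 0) :=
    Real.tendsto_exp_neg_atTop_nhds_zero.comp (tendsto_pow_atTop two_ne_zero)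
  obtain ⟨m, hm0, hm⟩ := ((eventually_ge_atTop 0).and (hlim.eventually_le_const hc0)).exists
  refine ⟨c, m + 2, hc0, by rw [hc]; linarith, by linarith, fun x hx y hy => ?_⟩
  rcases lt_or_ge y 0 with hy0 | hy0
  · rw [coverCdf_of_neg x hy0, mul_zero]; exact coverCdf_nonneg _ _
  rcases le_total y (x - 2) with h | h
  · have h1 := coverKer_growth hx hy0 h
    have h2 : coverCdf x (y + 2) ≤ coverCdf x (y + (m + 2)) := coverCdf_monotone x (by linarith)
    rw [coverCdf_of_nonneg x (by linarith : 0 ≤ y + 2)] at h2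
    rw [coverCdf_of_nonneg x hy0]
    rw [max_eq_left (by linarith : 0 ≤ x)] at *
    have := coverKer_nonneg x y
    nlinarith
  · have h1 : coverCdf x y ≤ η := by
      refine (coverCdf_monotone x hy).trans ?_
      rw [coverCdf_of_nonneg x (by linarith), max_eq_left (by linarith)]
      have := coverKer_add_add_le (x := 3) (y := 6) (t := x - 3) (by norm_num) (by norm_num)
        (by linarith)
      rwa [show (3 : ℝ) + (x - 3) = x by ring, show (6 : ℝ) + (x - 3) = x + 3 by ring] at this
    have h2 : coverCdf x (x + m) ≤ coverCdf x (y + (m + 2)) :=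
      coverCdf_monotone x (by linarith)
    have h3 := one_sub_exp_le_coverCdf (x := x) hm0 (by linarith)
    have h4 := coverCdf_nonneg x y
    nlinarith

lemma Gker_eq_coverCdf {x y : ℝ} (hy : 0 ≤ y) : Gker y (x - y) = coverCdf x y := by
  rw [Gker, if_pos hy, Gker0, sub_add_cancel, coverCdf_of_nonneg x hy]
  split_ifs with hx
  · rw [max_eq_right hx, coverKer_zero_left]
  · push Not at hx
    rw [max_eq_left hx.le, coverKer, ← tsum_mul_left]
    refine tsum_congr fun k => ?_
    have hs := (hasSum_poissonTail k (y ^ 2)).mul_left (Real.exp (y ^ 2))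
    have hE : Real.exp (y ^ 2) * Real.exp (-y ^ 2) = 1 := by
      rw [← Real.exp_add, add_neg_cancel, Real.exp_zero]
    have ht : HasSum (fun j : ℕ => if k ≤ j then y ^ (2 * j) / (j.factorial : ℝ) else 0)
        (Real.exp (y ^ 2) * poissonTail k (y ^ 2)) := by
      have h0 : ∑ j ∈ Finset.range k,
          (if k ≤ j then y ^ (2 * j) / (j.factorial : ℝ) else 0) = 0 :=
        Finset.sum_eq_zero fun j hj => if_neg (Finset.mem_range.1 hj).not_ge
      rw [← hasSum_nat_add_iff' k, h0, sub_zero]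
      have hd : (fun d => if k ≤ d + k then y ^ (2 * (d + k)) / ((d + k).factorial : ℝ) else 0) =
          fun d => Real.exp (y ^ 2) * poissonWeight (d + k) (y ^ 2) := funext fun d => by
        rw [if_pos (Nat.le_add_left k d), poissonWeight, ← mul_assoc, hE, one_mul, pow_mul]
      rwa [hd]
    rw [ht.tsum_eq, neg_add, Real.exp_add, poissonWeight, ← pow_mul]
    linear_combination (Real.exp (-x ^ 2) * x ^ (2 * k) / (k.factorial : ℝ) *
      poissonTail k (y ^ 2)) * hE

/-- The law of `y` under the cumulative distribution function `coverCdf x`. -/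
noncomputable def coverMeasure (x : ℝ) : Measure ℝ :=
  StieltjesFunction.measure (R := ℝ) ⟨coverCdf x, coverCdf_monotone x, coverCdf_rightContinuous x⟩

instance (x : ℝ) : IsProbabilityMeasure (coverMeasure x) :=
  ⟨by rw [coverMeasure, StieltjesFunction.measure_univ _ (coverCdf_tendsto_atBot x)
    (coverCdf_tendsto_atTop x)]; simp⟩

lemma coverMeasure_Iic (x y : ℝ) : coverMeasure x (Iic y) = ENNReal.ofReal (coverCdf x y) := by
  rw [coverMeasure, StieltjesFunction.measure_Iic _ (coverCdf_tendsto_atBot x), sub_zero]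

lemma coverMeasure_real_Iic (x y : ℝ) : (coverMeasure x).real (Iic y) = coverCdf x y := by
  rw [measureReal_def, coverMeasure_Iic, ENNReal.toReal_ofReal (coverCdf_nonneg x y)]

lemma integral_coverCdf_add (μ : Measure ℝ) [IsProbabilityMeasure μ] (x M : ℝ) :
    ∫ y, coverCdf x (y + M) ∂μ = ∫ z, μ.real (Ici (z - M)) ∂(coverMeasure x) := by
  set s : Set (ℝ × ℝ) := {p | p.2 - M ≤ p.1} with hs
  have hsm : MeasurableSet s := measurableSet_le (measurable_snd.sub_const M) measurable_fst
  have h1 := Measure.prod_apply (μ := μ) (ν := coverMeasure x) hsm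
  have h2 := Measure.prod_apply_symm (μ := μ) (ν := coverMeasure x) hsm
  have e1 : ∀ y, Prod.mk y ⁻¹' s = Iic (y + M) := by
    intro y; ext z; simp [hs]
  have e2 : ∀ z, (fun y => (y, z)) ⁻¹' s = Ici (z - M) := by
    intro z; ext y; simp [hs]
  simp only [e1] at h1
  simp only [e2] at h2
  have m1 : Measurable fun y => coverMeasure x (Iic (y + M)) := by
    simpa only [e1] using measurable_measure_prodMk_left (ν := coverMeasure x) hsm
  have m2 : Measurable fun z => μ (Ici (z - M)) := by
    simpa only [e2] using measurable_measure_prodMk_right (μ := μ) hsm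
  simp_rw [← coverMeasure_real_Iic, measureReal_def]
  rw [integral_toReal m1.aemeasurable (ae_of_all _ fun y => measure_lt_top _ _),
    integral_toReal m2.aemeasurable (ae_of_all _ fun y => measure_lt_top _ _), ← h1, ← h2]

/-- Regularity of the complementary distribution functions `F̄ₙ`. -/
structure IsCoverTail (F : ℝ → ℝ) : Prop where
  antitone : Antitone F
  rightCts : ∀ x, ContinuousWithinAt F (Ici x) x
  nonneg : ∀ x, 0 ≤ F x
  le_one : ∀ x, F x ≤ 1
  eq_one : ∀ x, x < 0 → F x = 1
  tendsto : Tendsto F atTop (nhds 0)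

lemma IsCoverTail.monotone_sub {F : ℝ → ℝ} (hF : IsCoverTail F) :
    Monotone fun x => 1 - (2 * F x - F x ^ 2) := by
  intro x y hxy
  have := hF.antitone hxy
  have := hF.le_one x
  have := hF.le_one y
  simp only
  nlinarith

lemma IsCoverTail.rightCts_sub {F : ℝ → ℝ} (hF : IsCoverTail F) (x : ℝ) :
    ContinuousWithinAt (fun x => 1 - (2 * F x - F x ^ 2)) (Ici x) x :=
  continuousWithinAt_const.sub
    ((continuousWithinAt_const.mul (hF.rightCts x)).sub ((hF.rightCts x).pow 2))

lemma IsCoverTail.lsMeasure_eq {F : ℝ → ℝ} (hF : IsCoverTail F) :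
    lsMeasure (fun x => 2 * F x - F x ^ 2) = StieltjesFunction.measure (R := ℝ)
      ⟨fun x => 1 - (2 * F x - F x ^ 2), hF.monotone_sub, hF.rightCts_sub⟩ :=
  dif_pos ⟨hF.monotone_sub, hF.rightCts_sub⟩

lemma IsCoverTail.tendsto_sub_atTop {F : ℝ → ℝ} (hF : IsCoverTail F) :
    Tendsto (fun x => 1 - (2 * F x - F x ^ 2)) atTop (nhds 1) := by
  have := ((hF.tendsto.const_mul 2).sub (hF.tendsto.pow 2)).const_sub 1
  simpa using this

lemma IsCoverTail.tendsto_sub_atBot {F : ℝ → ℝ} (hF : IsCoverTail F) :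
    Tendsto (fun x => 1 - (2 * F x - F x ^ 2)) atBot (nhds 0) := by
  refine tendsto_const_nhds.congr' ?_
  filter_upwards [eventually_lt_atBot 0] with x hx
  rw [hF.eq_one x hx]; norm_num

lemma IsCoverTail.isProbabilityMeasure {F : ℝ → ℝ} (hF : IsCoverTail F) :
    IsProbabilityMeasure (lsMeasure fun x => 2 * F x - F x ^ 2) :=
  ⟨by rw [hF.lsMeasure_eq, StieltjesFunction.measure_univ _ hF.tendsto_sub_atBot
    hF.tendsto_sub_atTop]; simp⟩

lemma IsCoverTail.lsMeasure_real_Ici {F : ℝ → ℝ} (hF : IsCoverTail F) {z v : ℝ}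
    (hv : Tendsto F (nhdsWithin z (Iio z)) (nhds v)) :
    (lsMeasure fun x => 2 * F x - F x ^ 2).real (Ici z) = 2 * v - v ^ 2 := by
  have h01 : v ∈ Icc (0 : ℝ) 1 := isClosed_Icc.mem_of_tendsto hv
    (Eventually.of_forall fun x => ⟨hF.nonneg x, hF.le_one x⟩)
  have hl : Function.leftLim (fun x => 1 - (2 * F x - F x ^ 2)) z = 1 - (2 * v - v ^ 2) :=
    leftLim_eq_of_tendsto (((hv.const_mul 2).sub (hv.pow 2)).const_sub 1)
  rw [hF.lsMeasure_eq, measureReal_def, StieltjesFunction.measure_Ici _ hF.tendsto_sub_atTop]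
  change (ENNReal.ofReal (1 - Function.leftLim (fun x => 1 - (2 * F x - F x ^ 2)) z)).toReal = _
  rw [hl, ENNReal.toReal_ofReal]
  · ring
  · nlinarith [h01.1, h01.2]

section Recursion

variable {μ : Measure ℝ} [IsProbabilityMeasure μ]

lemma integrable_coverCdf_add (x M : ℝ) : Integrable (fun y => coverCdf x (y + M)) μ := by
  refine Integrable.of_bound ((coverCdf_monotone x).measurable.comp
    (measurable_id.add_const M)).aestronglyMeasurable 1 (ae_of_all _ fun y => ?_)
  rw [Real.norm_of_nonneg (coverCdf_nonneg _ _)]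
  exact coverCdf_le_one _ _

lemma integrable_coverCdf (x : ℝ) : Integrable (coverCdf x) μ := by
  simpa using integrable_coverCdf_add (μ := μ) x 0

lemma ae_nonneg_of_real_Ici (hμ : μ.real (Ici 0) = 1) : ∀ᵐ y ∂μ, 0 ≤ y := by
  have h := prob_compl_eq_zero_iff (μ := μ) (measurableSet_Ici (a := (0 : ℝ)))
  exact h.2 (by simpa [measureReal_def, ENNReal.toReal_eq_one_iff] using hμ)

lemma integral_Gker (hμ : μ.real (Ici 0) = 1) (x : ℝ) :
    ∫ y, Gker y (x - y) ∂μ = ∫ y, coverCdf x y ∂μ :=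
  integral_congr_ae ((ae_nonneg_of_real_Ici hμ).mono fun _ hy => Gker_eq_coverCdf hy)

lemma integral_coverCdf (x : ℝ) :
    ∫ y, coverCdf x y ∂μ = ∫ z, μ.real (Ici z) ∂(coverMeasure x) := by
  simpa using integral_coverCdf_add μ x 0

lemma integral_real_Ici_sub_le (hμ : μ.real (Ici 0) = 1) (x : ℝ) {M : ℝ} (hM : 0 ≤ M) :
    ∫ z, μ.real (Ici (z - M)) ∂(coverMeasure x) ≤ ∫ y, coverCdf (x - M) y ∂μ := by
  rw [← integral_coverCdf_add]
  exact integral_mono_ae (integrable_coverCdf_add x M) (integrable_coverCdf _)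
    ((ae_nonneg_of_real_Ici hμ).mono fun y hy => coverCdf_add_le hM x hy)

lemma continuous_integral_coverCdf : Continuous fun x => ∫ y, coverCdf x y ∂μ := by
  refine continuous_of_dominated (bound := fun _ => 1)
    (fun x => (coverCdf_monotone x).measurable.aestronglyMeasurable)
    (fun x => ae_of_all _ fun y => ?_) (integrable_const _)
    (ae_of_all _ coverCdf_continuous_left)
  rw [Real.norm_of_nonneg (coverCdf_nonneg _ _)]
  exact coverCdf_le_one _ _

lemma integral_coverCdf_of_nonpos (hμ : μ.real (Ici 0) = 1) {x : ℝ} (hx : x ≤ 0) :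
    ∫ y, coverCdf x y ∂μ = 1 := by
  rw [integral_congr_ae ((ae_nonneg_of_real_Ici hμ).mono fun y hy => coverCdf_of_nonpos hx hy)]
  simp

lemma tendsto_coverCdf_left (y : ℝ) : Tendsto (fun x => coverCdf x y) atTop (nhds 0) := by
  have h1 : Tendsto (fun x : ℝ => x - y) atTop atTop :=
    tendsto_atTop_add_const_right _ (-y) tendsto_id
  have h2 : Tendsto (fun x : ℝ => Real.exp (-(x - y) ^ 2)) atTop (nhds 0) :=
    Real.tendsto_exp_neg_atTop_nhds_zero.comp ((tendsto_pow_atTop (α := ℝ) two_ne_zero).comp h1)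
  refine tendsto_of_tendsto_of_tendsto_of_le_of_le' tendsto_const_nhds h2
    (Eventually.of_forall fun x => coverCdf_nonneg x y) ?_
  filter_upwards [eventually_ge_atTop y] with x hx
  simpa using coverCdf_sub_le_exp (x := x) (sub_nonneg.2 hx)

lemma isCoverTail_integral_coverCdf (hμ : μ.real (Ici 0) = 1) :
    IsCoverTail fun x => ∫ y, coverCdf x y ∂μ where
  antitone x z hxz := integral_mono (integrable_coverCdf z) (integrable_coverCdf x)
    fun y => coverCdf_antitone_left y hxz
  rightCts x := continuous_integral_coverCdf.continuousWithinAt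
  nonneg x := integral_nonneg fun y => coverCdf_nonneg x y
  le_one x := by
    have := integral_mono (integrable_coverCdf (μ := μ) x) (integrable_const 1)
      fun y => coverCdf_le_one x y
    simpa using this
  eq_one x hx := integral_coverCdf_of_nonpos hμ hx.le
  tendsto := by
    have := tendsto_integral_filter_of_dominated_convergence (μ := μ) (l := atTop)
      (F := fun x y => coverCdf x y) (f := fun _ => 0) (fun _ => 1)
      (Eventually.of_forall fun x => (coverCdf_monotone x).measurable.aestronglyMeasurable)
      (Eventually.of_forall fun x => ae_of_all _ fun y => by
        rw [Real.norm_of_nonneg (coverCdf_nonneg _ _)]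
        exact coverCdf_le_one _ _)
      (integrable_const _) (ae_of_all _ tendsto_coverCdf_left)
    simpa using this

end Recursion

/-- The abstract form of the recursion, in terms of the left limits of `F̄ₙ`. -/
structure IsCoverSeq (v : ℕ → ℝ → ℝ) : Prop where
  zero : ∀ x, v 0 x = if x ≤ 0 then 1 else 0
  antitone : ∀ n, Antitone (v n)
  nonneg : ∀ n x, 0 ≤ v n x
  le_one : ∀ n x, v n x ≤ 1
  eq_one : ∀ n x, x ≤ 0 → v n x = 1
  succ : ∀ n x, v (n + 1) x = ∫ z, (2 * v n z - v n z ^ 2) ∂(coverMeasure x)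
  le_succ_sub : ∀ n x M, 0 ≤ M →
    ∫ z, (2 * v n (z - M) - v n (z - M) ^ 2) ∂(coverMeasure x) ≤ v (n + 1) (x - M)

lemma exists_isCoverSeq {Fbar : ℕ → ℝ → ℝ} (hF0 : ∀ x : ℝ, Fbar 0 x = if x < 0 then 1 else 0)
    (hrec : ∀ (n : ℕ) (x : ℝ), Fbar (n + 1) x =
      ∫ y, Gker y (x - y) ∂(lsMeasure fun y => 2 * Fbar n y - (Fbar n y) ^ 2)) :
    ∃ v, IsCoverSeq v ∧ (∀ n, Antitone (Fbar n)) ∧ ∀ n, v (n + 1) = Fbar (n + 1) := by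
  set v : ℕ → ℝ → ℝ := fun n => match n with
    | 0 => fun x => if x ≤ 0 then 1 else 0
    | n + 1 => Fbar (n + 1) with hv
  set μ : ℕ → Measure ℝ := fun n => lsMeasure fun y => 2 * Fbar n y - (Fbar n y) ^ 2 with hμ
  have hmain : ∀ n, IsCoverTail (Fbar n) ∧
      (∀ z, Tendsto (Fbar n) (nhdsWithin z (Iio z)) (nhds (v n z))) ∧ v n 0 = 1 := by
    intro n
    induction n with
    | zero =>
      have hF : Fbar 0 = fun x => if x < 0 then 1 else 0 := funext hF0
      have hev : ∀ x : ℝ, Fbar 0 =ᶠ[nhdsWithin x (Ici x)] fun _ => Fbar 0 x := by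
        intro x
        rcases lt_or_ge x 0 with hx | hx
        · filter_upwards [mem_nhdsWithin_of_mem_nhds (Iio_mem_nhds hx)] with y hy
          rw [hF0, hF0, if_pos hx, if_pos (mem_Iio.1 hy)]
        · filter_upwards [self_mem_nhdsWithin] with y hy
          rw [hF0, hF0, if_neg hx.not_gt, if_neg (hx.trans hy).not_gt]
      refine ⟨⟨fun x y hxy => ?_, fun x => ?_, fun x => ?_, fun x => ?_, fun x hx => ?_, ?_⟩,
        fun z => ?_, by simp [hv]⟩
      · rw [hF0, hF0]; split_ifs <;> linarith
      · exact tendsto_const_nhds.congr' (hev x).symm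
      · rw [hF0]; split_ifs <;> norm_num
      · rw [hF0]; split_ifs <;> norm_num
      · rw [hF0, if_pos hx]
      · refine tendsto_const_nhds.congr' ?_
        filter_upwards [eventually_ge_atTop 0] with x hx
        rw [hF0, if_neg (not_lt.2 hx)]
      · refine tendsto_const_nhds.congr' ?_
        simp only [hv]
        rcases le_or_gt z 0 with hz | hz
        · filter_upwards [self_mem_nhdsWithin] with y hy
          rw [hF0, if_pos hz, if_pos (lt_of_lt_of_le hy hz)]
        · filter_upwards [mem_nhdsWithin_of_mem_nhds (Ioi_mem_nhds hz)] with y hy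
          rw [hF0, if_neg hz.not_ge, if_neg (not_lt.2 (le_of_lt hy))]
    | succ n ih =>
      obtain ⟨hT, hl, h0⟩ := ih
      have := hT.isProbabilityMeasure
      have h1 : (μ n).real (Ici 0) = 1 := by
        rw [hT.lsMeasure_real_Ici (hl 0), h0]; norm_num
      have hE : Fbar (n + 1) = fun x => ∫ y, coverCdf x y ∂(μ n) := by
        ext x; rw [hrec, integral_Gker h1]
      refine ⟨hE ▸ isCoverTail_integral_coverCdf h1, fun z => ?_, ?_⟩
      · have : Continuous (Fbar (n + 1)) := hE ▸ continuous_integral_coverCdf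
        exact this.continuousAt.tendsto.mono_left nhdsWithin_le_nhds
      · change Fbar (n + 1) 0 = 1
        rw [hE]; exact integral_coverCdf_of_nonpos h1 le_rfl
  have hIci : ∀ n z, (μ n).real (Ici z) = 2 * v n z - v n z ^ 2 := fun n z =>
    (hmain n).1.lsMeasure_real_Ici ((hmain n).2.1 z)
  have h1 : ∀ n, (μ n).real (Ici 0) = 1 := fun n => by
    rw [hIci, (hmain n).2.2]; norm_num
  have hE : ∀ n x, Fbar (n + 1) x = ∫ y, coverCdf x y ∂(μ n) := fun n x => by
    have := (hmain n).1.isProbabilityMeasure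
    rw [hrec, integral_Gker (h1 n)]
  have hanti : ∀ n, Antitone (v n) := by
    intro n
    cases n with
    | zero =>
      intro x y hxy
      simp only [hv]
      split_ifs <;> linarith
    | succ n => exact (hmain (n + 1)).1.antitone
  have hmem : ∀ n x, 0 ≤ v n x ∧ v n x ≤ 1 := by
    intro n x
    cases n with
    | zero => simp only [hv]; split_ifs <;> norm_num
    | succ n => exact ⟨(hmain (n + 1)).1.nonneg x, (hmain (n + 1)).1.le_one x⟩
  refine ⟨v, ⟨fun x => rfl, hanti, fun n x => (hmem n x).1, fun n x => (hmem n x).2,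
    fun n x hx => ?_, fun n x => ?_, fun n x M hM => ?_⟩, fun n => (hmain n).1.antitone,
    fun n => rfl⟩
  · exact le_antisymm (hmem n x).2 ((hmain n).2.2.symm.trans_le (hanti n hx))
  · have := (hmain n).1.isProbabilityMeasure
    change Fbar (n + 1) x = _
    rw [hE, integral_coverCdf]
    simp_rw [hIci]
  · have := (hmain n).1.isProbabilityMeasure
    change _ ≤ Fbar (n + 1) (x - M)
    rw [hE]
    simp_rw [← hIci]
    exact integral_real_Ici_sub_le (h1 n) x hM

/-- A measure on the half-line whose distribution function grows geometrically up to `Y`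
gives geometric growth of integrals of nonincreasing functions supported on `(-∞, Y]`. -/
lemma one_add_mul_integral_le {ν : Measure ℝ} [IsProbabilityMeasure ν] {Y c m M : ℝ}
    (hc : 0 ≤ c) (hM : m < M)
    (hgrow : ∀ y ≤ Y, (1 + c) * ν.real (Iic y) ≤ ν.real (Iic (y + m)))
    {φ : ℝ → ℝ} (hφ : Antitone φ) (hφ0 : ∀ z, 0 ≤ φ z) (hφY : ∀ z, Y < z → φ z = 0)
    (hi : Integrable φ ν) (hiM : Integrable (fun z => φ (z - M)) ν) :
    (1 + c) * ∫ z, φ z ∂ν ≤ ∫ z, φ (z - M) ∂ν := by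
  have hφm := hφ.measurable
  have hset : ∀ t, 0 < t →
      ENNReal.ofReal (1 + c) * ν {z | t < φ z} ≤ ν {z | t < φ (z - M)} := by
    intro t ht
    rcases eq_empty_or_nonempty {z | t < φ z} with he | hne
    · rw [he]; simp
    have hbdd : ∀ z ∈ {z | t < φ z}, z ≤ Y := by
      intro z hz
      by_contra! h
      have : t < φ z := hz
      rw [hφY z h] at this
      linarith
    have hb : BddAbove {z | t < φ z} := ⟨Y, hbdd⟩
    set s := sSup {z | t < φ z}
    have hsY : s ≤ Y := csSup_le hne hbdd
    have h1 : {z | t < φ z} ⊆ Iic s := fun z hz => le_csSup hb hz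
    have h2 : Iic (s + m) ⊆ {z | t < φ (z - M)} := by
      intro z hz
      have hz' : z - M < s := by rw [mem_Iic] at hz; linarith
      obtain ⟨y, hy, hzy⟩ := exists_lt_of_lt_csSup hne hz'
      exact lt_of_lt_of_le hy (hφ hzy.le)
    calc ENNReal.ofReal (1 + c) * ν {z | t < φ z} ≤ ENNReal.ofReal (1 + c) * ν (Iic s) := by
          gcongr
      _ = ENNReal.ofReal ((1 + c) * ν.real (Iic s)) := by
          rw [ENNReal.ofReal_mul (by linarith), ofReal_measureReal]
      _ ≤ ENNReal.ofReal (ν.real (Iic (s + m))) := ENNReal.ofReal_le_ofReal (hgrow s hsY)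
      _ = ν (Iic (s + m)) := ofReal_measureReal
      _ ≤ _ := measure_mono h2
  have hl : ENNReal.ofReal (1 + c) * ∫⁻ z, ENNReal.ofReal (φ z) ∂ν ≤
      ∫⁻ z, ENNReal.ofReal (φ (z - M)) ∂ν := by
    rw [lintegral_eq_lintegral_meas_lt ν (ae_of_all _ hφ0) hφm.aemeasurable,
      lintegral_eq_lintegral_meas_lt ν (ae_of_all _ fun z => hφ0 (z - M))
        (hφm.comp (measurable_id.sub_const M)).aemeasurable,
      ← lintegral_const_mul' _ _ ENNReal.ofReal_ne_top]
    exact setLIntegral_mono' measurableSet_Ioi fun t ht => hset t ht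
  rw [← ofReal_integral_eq_lintegral_ofReal hi (ae_of_all _ hφ0),
    ← ofReal_integral_eq_lintegral_ofReal hiM (ae_of_all _ fun z => hφ0 (z - M)),
    ← ENNReal.ofReal_mul (by linarith)] at hl
  exact (ENNReal.ofReal_le_ofReal_iff (integral_nonneg fun z => hφ0 (z - M))).1 hl

lemma exp_moment_le {ν : Measure ℝ} [IsProbabilityMeasure ν] (hν : ∀ᵐ z ∂ν, 0 ≤ z)
    {B Y c m M θ : ℝ} (hBY : B ≤ Y) (hc : 0 < c) (hM : m < M) (hM0 : 0 ≤ M) (hθ : 0 ≤ θ)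
    (hθM : Real.exp (θ * M) = 1 + c / 20)
    (hgrow : ∀ y ≤ Y, (1 + c) * ν.real (Iic y) ≤ ν.real (Iic (y + m))) :
    Integrable (fun z => Real.exp (θ * max (B - z) 0)) ν ∧
      ∫ z, Real.exp (θ * max (B - z) 0) ∂ν ≤ 20 / 19 := by
  have hanti : Antitone fun z => Real.exp (θ * max (B - z) 0) := by
    intro y z hyz
    simp only
    gcongr
  have hint : ∀ N, 0 ≤ N → Integrable (fun z => Real.exp (θ * max (B - (z - N)) 0)) ν := by
    intro N hN
    refine Integrable.of_bound (hanti.measurable.comp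
      (measurable_id.sub_const N)).aestronglyMeasurable (Real.exp (θ * max (B + N) 0))
      (hν.mono fun z hz => ?_)
    rw [Real.norm_of_nonneg (Real.exp_nonneg _)]
    gcongr
    linarith
  have h0 : Integrable (fun z => Real.exp (θ * max (B - z) 0)) ν := by simpa using hint 0 le_rfl
  refine ⟨h0, ?_⟩
  have hL := one_add_mul_integral_le hc.le hM hgrow
    (φ := fun z => Real.exp (θ * max (B - z) 0) - 1)
    (fun y z hyz => sub_le_sub_right (hanti hyz) 1)
    (fun z => sub_nonneg.2 (Real.one_le_exp (mul_nonneg hθ (le_max_right _ _))))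
    (fun z hz => by rw [max_eq_right (by linarith)]; simp)
    (h0.sub (integrable_const 1)) ((hint M hM0).sub (integrable_const 1))
  have hle : ∫ z, Real.exp (θ * max (B - (z - M)) 0) ∂ν ≤
      ∫ z, (1 + c / 20) * Real.exp (θ * max (B - z) 0) ∂ν := by
    refine integral_mono (hint M hM0) (h0.const_mul _) fun z => ?_
    simp only
    rw [← hθM, ← Real.exp_add, ← mul_add]
    gcongr
    exact max_le (by linarith [le_max_left (B - z) 0]) (by linarith [le_max_right (B - z) 0])
  rw [integral_const_mul] at hle
  rw [integral_sub h0 (integrable_const 1), integral_sub (hint M hM0) (integrable_const 1)] at hL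
  simp only [integral_const, probReal_univ, smul_eq_mul, mul_one] at hL
  have : c * (19 / 20) * ∫ z, Real.exp (θ * max (B - z) 0) ∂ν ≤ c * (19 / 20) * (20 / 19) := by
    linarith
  exact le_of_mul_le_mul_left this (by positivity)

set_option maxHeartbeats 1000000 in
/-- Truncation step: the quadratic defect of a nonincreasing function is dominated by the square of
its value at `B`. -/
lemma one_add_mul_integral_sub_le {ν : Measure ℝ} [IsProbabilityMeasure ν]
    (hν : ∀ᵐ z ∂ν, 0 ≤ z) {B c m M θ ε K : ℝ} (hc : 0 < c) (hc2 : c ≤ 1 / 2) (hm : 0 ≤ m)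
    (hM : m + 1 < M) (hθ : 0 < θ) (hθM : Real.exp (2 * θ * M) = 1 + c / 20)
    (hε : 0 < ε) (hεc : ε ≤ c) (hεg : ε ≤ (1 - Real.exp (-θ)) / 2)
    (hεcg : ε ≤ c * ((1 - Real.exp (-θ)) / 2)) (hK : 0 ≤ K)
    (hgrow : ∀ y ≤ B + 1, (1 + c) * ν.real (Iic y) ≤ ν.real (Iic (y + m)))
    {w : ℝ → ℝ} (hw : Antitone w) (hw0 : ∀ z, 0 ≤ w z) (hw1 : ∀ z, w z ≤ 1)
    (hwM : ∀ z, (1 + ε) * w z - K * w z ^ 2 ≤ w (z - M)) :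
    (1 + ε) * ∫ z, w z ∂ν - 11 / 10 * K * w B ^ 2 ≤ ∫ z, w (z - M) ∂ν := by
  have hM0 : 0 ≤ M := by linarith
  set g := (1 - Real.exp (-θ)) / 2 with hg
  set f : ℝ → ℝ := fun z => Real.exp (2 * θ * max (B - z) 0) with hf
  obtain ⟨hfi, hf1⟩ : Integrable f ν ∧ ∫ z, f z ∂ν ≤ 20 / 19 :=
    exp_moment_le hν (Y := B + 1) (by linarith) hc (by linarith : m < M) hM0 (by positivity)
      hθM hgrow
  have hω := hw0 B
  have hint : ∀ {ψ : ℝ → ℝ} (N : ℝ), Antitone ψ → (∀ z, 0 ≤ ψ z) → (∀ z, ψ z ≤ 1) →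
      Integrable (fun z => ψ (z - N)) ν := fun {ψ} N h1 h2 h3 =>
    Integrable.of_bound (h1.measurable.comp (measurable_id.sub_const N)).aestronglyMeasurable 1
      (ae_of_all _ fun z => by
        change ‖ψ (z - N)‖ ≤ 1
        rw [Real.norm_of_nonneg (h2 _)]; exact h3 _)
  have hint0 : ∀ {ψ : ℝ → ℝ}, Antitone ψ → (∀ z, 0 ≤ ψ z) → (∀ z, ψ z ≤ 1) →
      Integrable ψ ν := fun {ψ} h1 h2 h3 => by simpa using hint 0 h1 h2 h3
  set e : ℝ → ℝ := fun z => if B ≤ z then w B else w B * Real.exp (θ * (1 + B - z)) with he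
  have hsq : ∀ z, e z ^ 2 ≤ w B ^ 2 * Real.exp (2 * θ) * f z := by
    intro z
    simp only [he, hf]
    rw [mul_assoc, ← Real.exp_add]
    split_ifs with h
    · refine le_mul_of_one_le_right (sq_nonneg _) (Real.one_le_exp ?_)
      have := le_max_right (B - z) 0
      positivity
    · rw [max_eq_left (by linarith), mul_pow, ← Real.exp_nat_mul]
      gcongr
      push_cast
      linarith
  have he0 : ∀ z, 0 ≤ e z := fun z => by simp only [he]; split_ifs <;> positivity
  have hEe : K * (w B ^ 2 * Real.exp (2 * θ) * ∫ z, f z ∂ν) ≤ 11 / 10 * K * w B ^ 2 := by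
    have h1 : Real.exp (2 * θ) ≤ 41 / 40 := by
      have : Real.exp (2 * θ) ≤ Real.exp (2 * θ * M) := Real.exp_le_exp.2 (by nlinarith)
      linarith
    have h2 : 0 ≤ ∫ z, f z ∂ν := integral_nonneg fun z => Real.exp_nonneg _
    have h3 : Real.exp (2 * θ) * ∫ z, f z ∂ν ≤ 41 / 40 * (20 / 19) := by gcongr
    have h4 : 0 ≤ K * w B ^ 2 := by positivity
    nlinarith
  have hEi : Integrable (fun z => K * (w B ^ 2 * Real.exp (2 * θ) * f z)) ν :=
    (hfi.const_mul _).const_mul _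
  have hEint : ∫ z, K * (w B ^ 2 * Real.exp (2 * θ) * f z) ∂ν =
      K * (w B ^ 2 * Real.exp (2 * θ) * ∫ z, f z ∂ν) := by
    rw [integral_const_mul, integral_const_mul]
  have hwi := hint0 hw hw0 hw1
  by_cases hall : ∀ z, w z ≤ e z
  · have h := integral_mono (μ := ν) ((hwi.const_mul (1 + ε)).sub hEi) (hint M hw hw0 hw1)
      fun z => by
        have h1 : w z ^ 2 ≤ w B ^ 2 * Real.exp (2 * θ) * f z :=
          (pow_le_pow_left₀ (hw0 z) (hall z) 2).trans (hsq z)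
        have h2 := mul_le_mul_of_nonneg_left h1 hK
        have h3 := hwM z
        simp only [Pi.sub_apply]
        linarith
    have h' := integral_sub (hwi.const_mul (1 + ε)) hEi
    rw [integral_const_mul, hEint] at h'
    simp only [Pi.sub_apply] at h
    linarith
  push Not at hall
  have hSB : ∀ z ∈ {z | e z < w z}, z < B := by
    intro z hz
    by_contra! h
    have hz' : e z < w z := hz
    simp only [he, if_pos h] at hz'
    exact hz'.not_ge (hw h)
  have hSb : BddAbove {z | e z < w z} := ⟨B, fun z hz => (hSB z hz).le⟩
  set z₀ := sSup {z | e z < w z}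
  have hz₀ : z₀ ≤ B := csSup_le hall fun z hz => (hSB z hz).le
  set e₀ := w B * Real.exp (θ * (1 + B - z₀)) with he₀
  have he₀0 : 0 ≤ e₀ := by positivity
  have habove : ∀ z, z₀ < z → w z ≤ e z := fun z hz => by
    by_contra! h
    exact hz.not_ge (le_csSup hSb h)
  have hele : ∀ z, z₀ < z → e z ≤ e₀ := by
    intro z hz
    simp only [he, he₀]
    split_ifs with h
    · exact le_mul_of_one_le_right hω (Real.one_le_exp (by nlinarith))
    · gcongr
  have hele' : ∀ z, z₀ + 1 ≤ z → e z ≤ Real.exp (-θ) * e₀ := by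
    intro z hz
    simp only [he, he₀]
    rw [mul_left_comm, ← Real.exp_add]
    split_ifs with h
    · exact le_mul_of_one_le_right hω (Real.one_le_exp (by nlinarith))
    · gcongr
      nlinarith
  have hbelow : ∀ z, z < z₀ → e₀ ≤ w z := by
    intro z hz
    obtain ⟨y, hy, hzy⟩ := exists_lt_of_lt_csSup hall hz
    have hyz : y ≤ z₀ := le_csSup hSb hy
    have hy' : e y < w y := hy
    simp only [he, if_neg (hSB y hy).not_ge] at hy'
    have : e₀ ≤ w B * Real.exp (θ * (1 + B - y)) := by rw [he₀]; gcongr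
    exact this.trans (hy'.le.trans (hw hzy.le))
  set w₁ : ℝ → ℝ := fun z => min (w z) e₀ with hw₁
  set w₂ : ℝ → ℝ := fun z => max (w z - e₀) 0 with hw₂
  have hsum : ∀ z, w z = w₁ z + w₂ z := by
    intro z
    simp only [hw₁, hw₂]
    rcases le_total (w z) e₀ with h | h
    · rw [min_eq_left h, max_eq_right (by linarith)]; ring
    · rw [min_eq_right h, max_eq_left (by linarith)]; ring
  have hw₁a : Antitone w₁ := fun y z hyz => min_le_min_right _ (hw hyz)
  have hw₂a : Antitone w₂ := fun y z hyz => max_le_max_right _ (sub_le_sub_right (hw hyz) _)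
  have hw₁0 : ∀ z, 0 ≤ w₁ z := fun z => le_min (hw0 z) he₀0
  have hw₂0 : ∀ z, 0 ≤ w₂ z := fun z => le_max_right _ _
  have hw₁1 : ∀ z, w₁ z ≤ 1 := fun z => (min_le_left _ _).trans (hw1 z)
  have hw₂1 : ∀ z, w₂ z ≤ 1 := fun z => max_le (by linarith [hw1 z]) zero_le_one
  have hL := one_add_mul_integral_le hc.le (by linarith : m < M) hgrow hw₂a hw₂0
    (fun z hz => max_eq_right (by
      have := (habove z (by linarith)).trans (hele z (by linarith))
      linarith))
    (hint0 hw₂a hw₂0 hw₂1) (hint M hw₂a hw₂0 hw₂1)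
  have hT : ∀ z, (1 + ε) * w₁ z - K * (w B ^ 2 * Real.exp (2 * θ) * f z) +
      e₀ * (g * (Iio (z₀ + M)).indicator 1 z - (g + ε) * (Iio (z₀ + 1)).indicator 1 z) ≤
      w₁ (z - M) := by
    intro z
    have hKe := mul_le_mul_of_nonneg_left (hsq z) hK
    have hKe0 : 0 ≤ K * e z ^ 2 := by positivity
    have hw₁e : w₁ z ≤ e₀ := min_le_right _ _
    have hw₁w : w₁ z ≤ w z := min_le_left _ _
    rcases lt_or_ge z (z₀ + 1) with h1 | h1
    · have h2 : w₁ (z - M) = e₀ := min_eq_right (hbelow _ (by linarith))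
      rw [indicator_of_mem (by rw [mem_Iio]; linarith), indicator_of_mem (by rwa [mem_Iio]), h2,
        Pi.one_apply]
      nlinarith
    · have hb := hele' z h1
      have hwz := habove z (by linarith)
      have hq : w₁ z ≤ Real.exp (-θ) * e₀ := hw₁w.trans (hwz.trans hb)
      have hge : (1 + ε) * w₁ z + g * e₀ ≤ e₀ := by
        have h3 : Real.exp (-θ) = 1 - 2 * g := by rw [hg]; ring
        rw [h3] at hq
        have hg0 : 0 ≤ g := hε.le.trans hεg
        have h4 : (1 + ε) * w₁ z ≤ (1 + ε) * ((1 - 2 * g) * e₀) := by gcongr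
        have h5 : (1 + ε) * (1 - 2 * g) + g ≤ 1 := by nlinarith
        nlinarith
      have hn : z ∉ Iio (z₀ + 1) := by rw [mem_Iio]; exact h1.not_gt
      rw [indicator_of_notMem hn]
      rcases lt_or_ge z (z₀ + M) with h2 | h2
      · have h2' : w₁ (z - M) = e₀ := min_eq_right (hbelow _ (by linarith))
        rw [indicator_of_mem (by rwa [mem_Iio]), h2', Pi.one_apply]
        linarith
      · have hn2 : z ∉ Iio (z₀ + M) := by rw [mem_Iio]; exact h2.not_gt
        rw [indicator_of_notMem hn2]
        simp only [mul_zero, sub_zero, add_zero]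
        refine le_min ?_ ?_
        · have h3 := hwM z
          have h4 : K * w z ^ 2 ≤ K * e z ^ 2 := by
            have := hw0 z
            gcongr
          nlinarith
        · have : 0 ≤ g * e₀ := mul_nonneg (hε.le.trans hεg) he₀0
          linarith
  have hind : ∀ y, Integrable ((Iio y).indicator (1 : ℝ → ℝ)) ν := fun y =>
    (integrable_const (1 : ℝ)).indicator measurableSet_Iio
  have hindv : ∀ y, ∫ z, (Iio y).indicator (1 : ℝ → ℝ) z ∂ν = ν.real (Iio y) := fun y =>
    integral_indicator_one measurableSet_Iio
  have hw₁i := hint0 hw₁a hw₁0 hw₁1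
  have hw₂i := hint0 hw₂a hw₂0 hw₂1
  have hA := (hw₁i.const_mul (1 + ε)).sub hEi
  have hBi := ((((hind (z₀ + M)).const_mul g).sub ((hind (z₀ + 1)).const_mul (g + ε))).const_mul e₀)
  have hI := integral_mono (μ := ν) (hA.add hBi) (hint M hw₁a hw₁0 hw₁1) hT
  have hIv : ∫ z, ((1 + ε) * w₁ z - K * (w B ^ 2 * Real.exp (2 * θ) * f z) +
      e₀ * (g * (Iio (z₀ + M)).indicator 1 z - (g + ε) * (Iio (z₀ + 1)).indicator 1 z)) ∂ν =
      (1 + ε) * ∫ z, w₁ z ∂ν - K * (w B ^ 2 * Real.exp (2 * θ) * ∫ z, f z ∂ν) +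
      e₀ * (g * ν.real (Iio (z₀ + M)) - (g + ε) * ν.real (Iio (z₀ + 1))) := by
    have a1 := integral_add hA hBi
    have a2 := integral_sub (hw₁i.const_mul (1 + ε)) hEi
    have a3 := integral_sub ((hind (z₀ + M)).const_mul g) ((hind (z₀ + 1)).const_mul (g + ε))
    rw [integral_const_mul, integral_const_mul, hindv, hindv] at a3
    rw [integral_const_mul, hEint] at a2
    rw [integral_const_mul e₀] at a1
    simp only [Pi.sub_apply] at a1
    rw [a1, a2, a3]
  have hmass : (1 + c) * ν.real (Iio (z₀ + 1)) ≤ ν.real (Iio (z₀ + M)) := by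
    have h1 : ν.real (Iio (z₀ + 1)) ≤ ν.real (Iic (z₀ + 1)) := measureReal_mono Iio_subset_Iic_self
    have h2 : ν.real (Iic (z₀ + 1 + m)) ≤ ν.real (Iio (z₀ + M)) :=
      measureReal_mono (Iic_subset_Iio.2 (by linarith))
    have h3 := hgrow (z₀ + 1) (by linarith)
    nlinarith
  have hpos : 0 ≤ e₀ * (g * ν.real (Iio (z₀ + M)) - (g + ε) * ν.real (Iio (z₀ + 1))) := by
    refine mul_nonneg he₀0 ?_
    have h1 : 0 ≤ ν.real (Iio (z₀ + 1)) := measureReal_nonneg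
    have hg0 : 0 ≤ g := hε.le.trans hεg
    nlinarith [mul_le_mul_of_nonneg_left hmass hg0, mul_le_mul_of_nonneg_right hεcg h1]
  have s1 : ∫ z, w z ∂ν = ∫ z, w₁ z ∂ν + ∫ z, w₂ z ∂ν := by
    rw [← integral_add hw₁i hw₂i]; exact integral_congr_ae (ae_of_all _ hsum)
  have s2 : ∫ z, w (z - M) ∂ν = ∫ z, w₁ (z - M) ∂ν + ∫ z, w₂ (z - M) ∂ν := by
    rw [← integral_add (hint M hw₁a hw₁0 hw₁1) (hint M hw₂a hw₂0 hw₂1)]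
    exact integral_congr_ae (ae_of_all _ fun z => hsum _)
  have s3 : 0 ≤ ∫ z, w₂ z ∂ν := integral_nonneg hw₂0
  simp only [Pi.add_apply, Pi.sub_apply] at hI
  rw [hIv] at hI
  rw [s1, s2]
  nlinarith

lemma coverMeasure_ae_nonneg (x : ℝ) : ∀ᵐ z ∂(coverMeasure x), 0 ≤ z := by
  have hl : Function.leftLim (coverCdf x) 0 = 0 := by
    refine leftLim_eq_of_tendsto (tendsto_const_nhds.congr' ?_)
    filter_upwards [self_mem_nhdsWithin] with y hy
    exact (coverCdf_of_neg x hy).symm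
  have h : coverMeasure x (Iio 0) = 0 := by
    rw [coverMeasure, StieltjesFunction.measure_Iio _ (coverCdf_tendsto_atBot x)]
    change ENNReal.ofReal (Function.leftLim (coverCdf x) 0 - 0) = 0
    rw [hl]; simp
  rw [ae_iff]
  simp only [not_le]
  exact h

lemma two_mul_sub_sq_le_one (u : ℝ) : 2 * u - u ^ 2 ≤ 1 := by
  nlinarith [sq_nonneg (1 - u)]

namespace IsCoverSeq

variable {v : ℕ → ℝ → ℝ} (hv : IsCoverSeq v)
include hv

lemma antitone_sq (n : ℕ) : Antitone fun z => 2 * v n z - v n z ^ 2 := by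
  intro y z hyz
  have := hv.antitone n hyz
  have := hv.le_one n y
  have := hv.le_one n z
  simp only
  nlinarith

lemma sq_nonneg (n : ℕ) (z : ℝ) : 0 ≤ 2 * v n z - v n z ^ 2 := by
  have := hv.nonneg n z
  have := hv.le_one n z
  nlinarith

lemma integrable_sq (n : ℕ) (x : ℝ) :
    Integrable (fun z => 2 * v n z - v n z ^ 2) (coverMeasure x) := by
  refine Integrable.of_bound (hv.antitone_sq n).measurable.aestronglyMeasurable 1
    (ae_of_all _ fun z => ?_)
  rw [Real.norm_of_nonneg (hv.sq_nonneg n z)]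
  exact two_mul_sub_sq_le_one _

lemma mul_coverCdf_le (n : ℕ) (x y : ℝ) :
    (2 * v n y - v n y ^ 2) * coverCdf x y ≤ v (n + 1) x := by
  have h := integral_mono (μ := coverMeasure x)
    (f := (Iic y).indicator fun _ => 2 * v n y - v n y ^ 2)
    ((integrable_const _).indicator measurableSet_Iic) (hv.integrable_sq n x) fun z => by
      by_cases hz : z ∈ Iic y
      · rw [indicator_of_mem hz]; exact hv.antitone_sq n hz
      · rw [indicator_of_notMem hz]; exact hv.sq_nonneg n z
  rw [integral_indicator_const _ measurableSet_Iic, coverMeasure_real_Iic, ← hv.succ,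
    smul_eq_mul] at h
  linarith

lemma le_add_coverCdf (n : ℕ) (x y : ℝ) :
    v (n + 1) x ≤ 2 * v n y - v n y ^ 2 + coverCdf x y := by
  have hi : Integrable ((Iic y).indicator fun _ => (1 : ℝ)) (coverMeasure x) :=
    (integrable_const _).indicator measurableSet_Iic
  have h := integral_mono (μ := coverMeasure x) (hv.integrable_sq n x)
    ((integrable_const (2 * v n y - v n y ^ 2)).add hi) fun z => by
      simp only [Pi.add_apply]
      by_cases hz : z ∈ Iic y
      · rw [indicator_of_mem hz]
        linarith [two_mul_sub_sq_le_one (v n z), hv.sq_nonneg n y]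
      · rw [indicator_of_notMem hz, add_zero]
        exact hv.antitone_sq n (le_of_not_ge hz)
  have h2 := integral_add (integrable_const (2 * v n y - v n y ^ 2)) hi
  rw [integral_indicator_const _ measurableSet_Iic, coverMeasure_real_Iic] at h2
  simp only [integral_const, probReal_univ, smul_eq_mul, one_mul, mul_one] at h2
  simp only [Pi.add_apply] at h
  rw [h2, ← hv.succ] at h
  exact h

lemma mul_le_succ_sub (n : ℕ) (x : ℝ) {a : ℝ} (ha : 0 ≤ a) :
    (1 - Real.exp (-a ^ 2)) * (2 * v n x - v n x ^ 2) ≤ v (n + 1) (x - a) := by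
  have h0 := hv.sq_nonneg n x
  rcases lt_or_ge x 0 with hx | hx
  · rw [hv.eq_one (n + 1) (x - a) (by linarith)]
    nlinarith [two_mul_sub_sq_le_one (v n x), Real.exp_nonneg (-a ^ 2)]
  · have h1 := hv.mul_coverCdf_le n (x - a) x
    have h2 := one_sub_exp_le_coverCdf (x := x - a) ha (by linarith)
    rw [sub_add_cancel] at h2
    nlinarith

lemma succ_add_le (n : ℕ) (x : ℝ) {b : ℝ} (hb : 0 ≤ b) :
    v (n + 1) (x + b) ≤ 2 * v n x + Real.exp (-b ^ 2) := by
  have h1 := hv.le_add_coverCdf n (x + b) x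
  have h2 := coverCdf_sub_le_exp (x := x + b) hb
  rw [add_sub_cancel_right] at h2
  linarith [_root_.sq_nonneg (v n x)]

lemma add_le (n j : ℕ) (x : ℝ) {b : ℝ} (hb : 0 ≤ b) :
    v (n + j) (x + j * b) + Real.exp (-b ^ 2) ≤ 2 ^ j * (v n x + Real.exp (-b ^ 2)) := by
  induction j with
  | zero => simp
  | succ j ih =>
    have h := hv.succ_add_le (n + j) (x + j * b) hb
    rw [show x + ((j + 1 : ℕ) : ℝ) * b = x + j * b + b by push_cast; ring, pow_succ (2 : ℝ) j, ← add_assoc]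
    linarith

lemma min_le_sub {η a : ℝ} (hη : 0 < η) (hη2 : η ≤ 1 / 2) (ha : 0 ≤ a)
    (haη : Real.exp (-a ^ 2) ≤ η / 4) (n j : ℕ) (x : ℝ) :
    min (1 - η) ((1 + η / 2) ^ j * v n x) ≤ v (n + j) (x - j * a) := by
  induction j with
  | zero => simp
  | succ j ih =>
    have h := hv.mul_le_succ_sub (n + j) (x - j * a) ha
    rw [show x - ((j + 1 : ℕ) : ℝ) * a = x - j * a - a by push_cast; ring, ← add_assoc]
    set u := v (n + j) (x - j * a)
    have hu0 : 0 ≤ u := hv.nonneg _ _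
    have hu1 : u ≤ 1 := hv.le_one _ _
    have h' : (1 - η / 4) * (2 * u - u ^ 2) ≤ v (n + j + 1) (x - j * a - a) :=
      le_trans (mul_le_mul_of_nonneg_right (by linarith) (hv.sq_nonneg _ _)) h
    refine le_trans ?_ h'
    rcases le_or_gt (1 - η) u with hu | hu
    · refine (min_le_left _ _).trans ?_
      have h1 : 1 - η ^ 2 ≤ 2 * u - u ^ 2 := by nlinarith
      have h2 : (1 - η / 4) * (1 - η ^ 2) ≤ (1 - η / 4) * (2 * u - u ^ 2) := by
        gcongr
        linarith
      nlinarith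
    · refine (min_le_right _ _).trans ?_
      have h1 : (1 + η / 2) ^ j * v n x ≤ u :=
        (min_le_iff.1 ih).resolve_left (not_le.2 hu)
      have h2 : (1 + η / 2) * ((1 + η / 2) ^ j * v n x) ≤ (1 + η / 2) * u := by gcongr
      have h3 : (1 + η) * u ≤ 2 * u - u ^ 2 := by nlinarith
      have h4 : (1 - η / 4) * ((1 + η) * u) ≤ (1 - η / 4) * (2 * u - u ^ 2) := by
        gcongr
        linarith
      rw [pow_succ]
      nlinarith [mul_nonneg hη.le hu0, mul_nonneg (mul_nonneg hη.le hu0) (by linarith : 0 ≤ 1 - η)]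

end IsCoverSeq

/-- The map `u ↦ 2u - u²` improves the quadratic defect by the factor `8 / 5`. -/
lemma quadratic_step {u u' w' ε C : ℝ} (hε : 0 < ε) (hε1 : ε ≤ 1 / 200) (hC : 1 ≤ C)
    (hu0 : 0 ≤ u) (hu1 : u ≤ 1) (hu' : u ≤ u') (hu'1 : u' ≤ 1) (h : (1 + ε) * u - C * u ^ 2 ≤ u')
    (hw' : w' = 2 * u' - u' ^ 2) :
    (1 + ε) * (2 * u - u ^ 2) - 5 / 8 * C * (2 * u - u ^ 2) ^ 2 ≤ w' := by
  set w := 2 * u - u ^ 2 with hw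
  have hw0 : 0 ≤ w := by nlinarith
  have hww : w ≤ w' := by rw [hw, hw']; nlinarith
  rcases le_or_gt ε (5 / 8 * C * w) with hc | hc
  · nlinarith
  · have huw : u ≤ w := by nlinarith
    have hu2 : C * u ≤ 1 / 100 := by nlinarith
    have hu3 : u ≤ 1 / 100 := by nlinarith
    set k := (1 + ε) * u - C * u ^ 2 with hk
    have hk0 : 0 ≤ k := by nlinarith
    have hkle : k ≤ (1 + ε) * u := by nlinarith
    have h1 : 2 * k - k ^ 2 ≤ w' := by rw [hw']; nlinarith
    have h2 : k ^ 2 ≤ ((1 + ε) * u) ^ 2 := pow_le_pow_left₀ hk0 hkle 2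
    have h3 : w ^ 2 = u ^ 2 * (2 - u) ^ 2 := by rw [hw]; ring
    have h4 : (199 / 100) ^ 2 ≤ (2 - u) ^ 2 := pow_le_pow_left₀ (by norm_num) (by linarith) 2
    have h5 : u ^ 2 * (199 / 100) ^ 2 ≤ w ^ 2 := by rw [h3]; gcongr
    have h6 : 5 / 8 * C * (u ^ 2 * (199 / 100) ^ 2) ≤ 5 / 8 * C * w ^ 2 := by gcongr
    have h7 : u ^ 2 * (ε * (1 + ε)) ≤ u ^ 2 * (C * (4 / 10)) :=
      mul_le_mul_of_nonneg_left (by nlinarith) (sq_nonneg u)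
    have h8 : 0 ≤ u ^ 2 * C := by positivity
    refine le_trans ?_ h1
    rw [hk, hw]
    nlinarith

/-- The Lyapunov property: the left tails of all `v n` grow geometrically at small heights. -/
lemma exists_geometric_growth : ∃ M ε C : ℝ, 0 ≤ M ∧ 0 < ε ∧ ε ≤ C ∧
    ∀ v, IsCoverSeq v → ∀ n x, (1 + ε) * v n x - C * v n x ^ 2 ≤ v n (x - M) := by
  obtain ⟨c, m, hc, hc2, hm, hgrow⟩ := exists_coverCdf_growth
  set M := m + 2 with hM
  have hM0 : 0 < M := by linarith
  set θ := Real.log (1 + c / 20) / (2 * M) with hθ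
  have hlog : 0 < Real.log (1 + c / 20) := Real.log_pos (by linarith)
  have hθ0 : 0 < θ := by positivity
  have hθM : Real.exp (2 * θ * M) = 1 + c / 20 := by
    rw [show 2 * θ * M = Real.log (1 + c / 20) by rw [hθ]; field_simp,
      Real.exp_log (by linarith)]
  set g := (1 - Real.exp (-θ)) / 2 with hg
  have hg0 : 0 < g := by
    have : Real.exp (-θ) < 1 := Real.exp_lt_one_iff.2 (by linarith)
    rw [hg]; linarith
  have hg1 : g ≤ 1 / 2 := by have := Real.exp_nonneg (-θ); rw [hg]; linarith
  set ε := min (c * g) (1 / 200) with hε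
  have hε0 : 0 < ε := lt_min (by positivity) (by norm_num)
  have hεcg : ε ≤ c * g := min_le_left _ _
  have hε1 : ε ≤ 1 / 200 := min_le_right _ _
  set C := 2 * Real.exp 9 with hC
  have hC2 : 2 ≤ C := by
    have : 1 ≤ Real.exp 9 := Real.one_le_exp (by norm_num)
    rw [hC]; linarith
  refine ⟨M, ε, C, hM0.le, hε0, by linarith, fun v hv n => ?_⟩
  induction n with
  | zero =>
    intro x
    rw [hv.zero]
    have h0 := hv.nonneg 0 (x - M)
    split_ifs <;> linarith
  | succ n ih =>
    intro x
    have hu0 := hv.nonneg (n + 1) x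
    rcases lt_or_ge x 3 with hx | hx
    · have h1 := hv.mul_coverCdf_le n x 0
      rw [hv.eq_one n 0 le_rfl, coverCdf_of_nonneg x le_rfl, coverKer_zero_right] at h1
      have h2 : Real.exp (-9) ≤ Real.exp (-max x 0 ^ 2) := by
        have : max x 0 ≤ 3 := max_le hx.le (by norm_num)
        have := pow_le_pow_left₀ (le_max_right x 0) this 2
        exact Real.exp_le_exp.2 (by linarith)
      have h3 : Real.exp 9 * Real.exp (-9) = 1 := by
        rw [← Real.exp_add, add_neg_cancel, Real.exp_zero]
      have h4 : 2 ≤ C * v (n + 1) x := by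
        have : C * Real.exp (-9) ≤ C * v (n + 1) x := by
          gcongr
          linarith
        rw [hC] at this ⊢
        linarith
      have := hv.nonneg (n + 1) (x - M)
      nlinarith
    · have hstep : ∀ z, (1 + ε) * (2 * v n z - v n z ^ 2) -
          5 / 8 * C * (2 * v n z - v n z ^ 2) ^ 2 ≤ 2 * v n (z - M) - v n (z - M) ^ 2 := fun z =>
        quadratic_step hε0 hε1 (by linarith) (hv.nonneg n z) (hv.le_one n z)
          (hv.antitone n (by linarith)) (hv.le_one n _) (ih z) rfl
      have hmain := one_add_mul_integral_sub_le (coverMeasure_ae_nonneg x) (B := x + 2) hc hc2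
        (by linarith : 0 ≤ m) (by linarith : m + 1 < M) hθ0 hθM hε0 (by nlinarith) (by nlinarith)
        hεcg (by positivity : 0 ≤ 5 / 8 * C)
        (fun y hy => by
          rw [coverMeasure_real_Iic, coverMeasure_real_Iic]
          exact hgrow x hx y (by linarith))
        (hv.antitone_sq n) (hv.sq_nonneg n) (fun _ => two_mul_sub_sq_le_one _) hstep
      rw [← hv.succ] at hmain
      have hle := hmain.trans (hv.le_succ_sub n x M hM0.le)
      have hω0 := hv.sq_nonneg n (x + 2)
      have hω := hv.mul_le_succ_sub n (x + 2) (a := 2) (by norm_num)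
      rw [add_sub_cancel_right] at hω
      have he : Real.exp (-(2 : ℝ) ^ 2) ≤ 1 / 8 := by
        have h1 : (2 : ℝ) ^ 3 ≤ Real.exp 1 ^ 3 := by
          gcongr
          linarith [Real.add_one_le_exp (1 : ℝ)]
        rw [← Real.exp_nat_mul] at h1
        have h2 : Real.exp ((3 : ℕ) * 1) ≤ Real.exp 4 := Real.exp_le_exp.2 (by norm_num)
        rw [show (-2 ^ 2 : ℝ) = -4 by norm_num, Real.exp_neg, ← one_div]
        exact one_div_le_one_div_of_le (by norm_num) (by linarith)
      set ω := 2 * v n (x + 2) - v n (x + 2) ^ 2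
      have hω' : 7 / 8 * ω ≤ v (n + 1) x :=
        le_trans (mul_le_mul_of_nonneg_right (by linarith) hω0) hω
      have hsq : (7 / 8 * ω) ^ 2 ≤ v (n + 1) x ^ 2 := pow_le_pow_left₀ (by positivity) hω' 2
      nlinarith

lemma IsCoverSeq.exists_crossing {v : ℕ → ℝ → ℝ} (hv : IsCoverSeq v) (n : ℕ) {t : ℝ}
    (ht : 0 < t) (ht1 : t ≤ 1) : ∃ z, t ≤ v n (z - 1) ∧ v n (z + 1) ≤ t := by
  have hne : {z | t ≤ v n z}.Nonempty := ⟨0, ht1.trans (hv.eq_one n 0 le_rfl).ge⟩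
  have hlim : Tendsto (fun b : ℝ => Real.exp (-b ^ 2)) atTop (nhds 0) :=
    Real.tendsto_exp_neg_atTop_nhds_zero.comp (tendsto_pow_atTop two_ne_zero)
  obtain ⟨b, hb0, hb⟩ := ((eventually_ge_atTop 0).and
    (hlim.eventually_lt_const (by positivity : 0 < t / 2 ^ n))).exists
  have hup := hv.add_le 0 n 1 hb0
  rw [hv.zero, if_neg (by norm_num), zero_add, zero_add] at hup
  rw [lt_div_iff₀' (by positivity)] at hb
  have hlt : v n (1 + n * b) < t := by linarith [Real.exp_pos (-b ^ 2)]
  have hbdd : BddAbove {z | t ≤ v n z} := ⟨1 + n * b, fun z hz => by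
    by_contra! h
    exact (hlt.trans_le hz).not_ge (hv.antitone n h.le)⟩
  refine ⟨sSup {z | t ≤ v n z}, ?_, ?_⟩
  · obtain ⟨y, hy, hlt⟩ := exists_lt_of_lt_csSup hne (sub_one_lt (sSup {z | t ≤ v n z}))
    exact le_trans hy (hv.antitone n hlt.le)
  · by_contra! h
    exact (lt_add_one _).not_ge (le_csSup hbdd h.le)

lemma IsCoverSeq.tight {v : ℕ → ℝ → ℝ} (hv : IsCoverSeq v) {η : ℝ} (hη : 0 < η)
    (hη2 : η ≤ 1 / 2) :
    ∃ A, 0 ≤ A ∧ ∀ n, ∃ p q, q - p ≤ A ∧ 1 - η ≤ v n p ∧ v n q ≤ η := by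
  obtain ⟨M, ε, C, hM, hε, hεC, hgrow⟩ := exists_geometric_growth
  have hC : 0 < C := hε.trans_le hεC
  set t := ε / (2 * C) with ht
  have ht0 : 0 < t := by positivity
  have ht1 : t ≤ 1 := by rw [ht, div_le_one (by positivity)]; linarith
  have hdecay : ∀ n z, v n z ≤ t → ∀ k : ℕ, (1 + ε / 2) ^ k * v n (z + k * M) ≤ 1 := by
    intro n z hz k
    induction k with
    | zero => simpa using hv.le_one n z
    | succ k ih =>
      refine le_trans ?_ ih
      have h1 := hgrow v hv n (z + (k + 1 : ℕ) * M)
      rw [show z + ((k + 1 : ℕ) : ℝ) * M - M = z + k * M by push_cast; ring] at h1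
      have h2 : v n (z + (k + 1 : ℕ) * M) ≤ t :=
        (hv.antitone n (le_add_of_nonneg_right (by positivity))).trans hz
      have h3 := hv.nonneg n (z + (k + 1 : ℕ) * M)
      have h4 : C * v n (z + (k + 1 : ℕ) * M) ≤ ε / 2 := by
        rw [ht, le_div_iff₀ (by positivity)] at h2
        linarith
      rw [pow_succ, mul_assoc]
      gcongr
      nlinarith
  have hlim : Tendsto (fun b : ℝ => Real.exp (-b ^ 2)) atTop (nhds 0) :=
    Real.tendsto_exp_neg_atTop_nhds_zero.comp (tendsto_pow_atTop two_ne_zero)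
  obtain ⟨a, ha0, ha⟩ := ((eventually_ge_atTop 0).and
    (hlim.eventually_le_const (by positivity : 0 < η / 4))).exists
  obtain ⟨j, hj⟩ := pow_unbounded_of_one_lt (1 / t) (by linarith : 1 < 1 + η / 2)
  obtain ⟨b, hb0, hb⟩ := ((eventually_ge_atTop 0).and
    (hlim.eventually_le_const (by positivity : 0 < η / 2 ^ (j + 1)))).exists
  obtain ⟨k, hk⟩ := pow_unbounded_of_one_lt (2 ^ (j + 1) / η) (by linarith : 1 < 1 + ε / 2)
  rw [div_lt_iff₀ ht0] at hj
  rw [div_lt_iff₀ hη] at hk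
  rw [le_div_iff₀' (by positivity), pow_succ] at hb
  refine ⟨2 + j * a + k * M + j * b, by positivity, fun n => ?_⟩
  have hka : 0 ≤ j * a + k * M := by positivity
  rcases lt_or_ge n j with hn | hn
  · refine ⟨0, 1 + n * b, ?_, ?_, ?_⟩
    · have : (n : ℝ) * b ≤ j * b := by gcongr
      linarith
    · rw [hv.eq_one n 0 le_rfl]; linarith
    · have h1 := hv.add_le 0 n 1 hb0
      rw [hv.zero, if_neg (by norm_num), zero_add, zero_add] at h1
      have h2 : (2 : ℝ) ^ n * Real.exp (-b ^ 2) ≤ 2 ^ j * Real.exp (-b ^ 2) := by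
        gcongr
        norm_num
      linarith [Real.exp_pos (-b ^ 2)]
  · obtain ⟨i, rfl⟩ := Nat.exists_eq_add_of_le' hn
    obtain ⟨z, hz1, hz2⟩ := hv.exists_crossing i ht0 ht1
    refine ⟨z - 1 - j * a, z + 1 + k * M + j * b, by linarith, ?_, ?_⟩
    · have h1 := hv.min_le_sub hη hη2 ha0 ha i j (z - 1)
      refine le_trans (le_min le_rfl ?_) h1
      have : (1 + η / 2) ^ j * t ≤ (1 + η / 2) ^ j * v i (z - 1) := by gcongr
      linarith
    · have h1 := hv.add_le i j (z + 1 + k * M) hb0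
      have h2 := hdecay i (z + 1) hz2 k
      have h3 : 2 ^ (j + 1) * v i (z + 1 + k * M) ≤ η := by
        have h0 := hv.nonneg i (z + 1 + k * M)
        have : 2 ^ (j + 1) * v i (z + 1 + k * M) ≤
            (1 + ε / 2) ^ k * η * v i (z + 1 + k * M) := by gcongr
        nlinarith
      rw [pow_succ] at h3
      linarith [Real.exp_pos (-b ^ 2)]

/-- An antitone function dropping from `1 - η` to `η` on an interval of length at most `A`
is concentrated within distance `A` of its median. -/
lemma one_sub_le_of_drop {F : ℝ → ℝ} (hF : Antitone F) {η A p q : ℝ} (hη : η < 1 / 2)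
    (hpq : q - p ≤ A) (hp : 1 - η ≤ F p) (hq : F q ≤ η) :
    1 - 2 * η ≤ (1 - F (A + Med fun x => 1 - F x)) - (1 - F (-A + Med fun x => 1 - F x)) := by
  have hmem : q ∈ {x | 1 / 2 ≤ 1 - F x} := by
    change 1 / 2 ≤ 1 - F q
    linarith
  have hlb : ∀ x ∈ {x | 1 / 2 ≤ 1 - F x}, p ≤ x := by
    intro x hx
    by_contra! h
    have h1 : 1 / 2 ≤ 1 - F x := hx
    have h2 := hF h.le
    linarith
  have h1 : p ≤ Med fun x => 1 - F x := le_csInf ⟨q, hmem⟩ hlb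
  have h2 : (Med fun x => 1 - F x) ≤ q := csInf_le ⟨p, hlb⟩ hmem
  have h3 := hF (show q ≤ A + Med fun x => 1 - F x by linarith)
  have h4 := hF (show (-A + Med fun x => 1 - F x) ≤ p by linarith)
  linarith

/-- Theorem 4.3 (recursion form): for `Q(u) = 2u - u²` and the cover-time kernel `Ḡ`,
the distribution functions defined by `F̄₀(x) = 1_{x<0}` and
`F̄ₙ₊₁(x) = -∫ Ḡ(y, x-y) dQ(F̄ₙ(y))` are tight after centering. -/
theorem cover_time_recursion_tight
    (Fbar : ℕ → ℝ → ℝ)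
    (hF0 : ∀ x : ℝ, Fbar 0 x = if x < 0 then 1 else 0)
    (hrec : ∀ (n : ℕ) (x : ℝ), Fbar (n + 1) x =
      ∫ y, Gker y (x - y)
        ∂(lsMeasure fun y => 2 * Fbar n y - (Fbar n y) ^ 2)) :
    TightAfterCentering (fun n x => 1 - Fbar n x) := by
  intro ε hε
  obtain ⟨v, hv, hanti, hvF⟩ := exists_isCoverSeq hF0 hrec
  obtain ⟨η, hη, hη2, hηε⟩ : ∃ η : ℝ, 0 < η ∧ η < 1 / 2 ∧ 2 * η < ε :=
    ⟨min (ε / 3) (1 / 3), by positivity, (min_le_right _ _).trans_lt (by norm_num),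
      by linarith [min_le_left (ε / 3) (1 / 3)]⟩
  obtain ⟨A, hA, htight⟩ := hv.tight hη hη2.le
  refine ⟨A + 1, by linarith, fun n => ?_⟩
  obtain ⟨p, q, hpq, hp, hq⟩ : ∃ p q, q - p ≤ A + 1 ∧ 1 - η ≤ Fbar n p ∧ Fbar n q ≤ η := by
    cases n with
    | zero =>
      refine ⟨-1, 0, by linarith, ?_, ?_⟩
      · rw [hF0, if_pos (by norm_num)]; linarith
      · rw [hF0, if_neg (lt_irrefl 0)]; exact hη.le
    | succ n =>
      obtain ⟨p, q, h1, h2, h3⟩ := htight (n + 1)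
      rw [hvF] at h2 h3
      exact ⟨p, q, by linarith, h2, h3⟩
  have := one_sub_le_of_drop (hanti n) hη2 hpq hp hq
  linarith
end

section
/- Inequality (4.19). For the kernel Ḡ defined in the context, there exists a constant C₃ > 0 such that for all y > 2 and all x ≥ y, Ḡ(y, x − y) ≤ C₃·√(xy)·e^{−(x−y)²}. -/
/-- The Poisson tail series, tilted by `(x / y) ^ (j - k) ≥ 1` on `j ≥ k`. -/
theorem tsum_tail_le_exp_mul {x y : ℝ} (hy : 0 < y) (hyx : y ≤ x) (k : ℕ) :
    ∑' j : ℕ, (if k ≤ j then y ^ (2 * j) / (Nat.factorial j : ℝ) else 0) ≤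
      (y / x) ^ k * Real.exp (x * y) := by
  have hx : 0 < x := hy.trans_le hyx
  have hexp : HasSum (fun j : ℕ => (y / x) ^ k * ((x * y) ^ j / (Nat.factorial j : ℝ)))
      ((y / x) ^ k * Real.exp (x * y)) := by
    rw [Real.exp_eq_exp_ℝ]
    exact (NormedSpace.expSeries_div_hasSum_exp (x * y)).mul_left _
  have hle (j : ℕ) : (if k ≤ j then y ^ (2 * j) / (Nat.factorial j : ℝ) else 0) ≤
      (y / x) ^ k * ((x * y) ^ j / (Nat.factorial j : ℝ)) := by
    split_ifs with h
    · have hpow : y ^ (2 * j) = (y / x) ^ j * (x * y) ^ j := by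
        rw [← mul_pow, pow_mul]
        congr 1
        field_simp
      rw [hpow, mul_div_assoc]
      gcongr ?_ * _
      exact pow_le_pow_of_le_one (by positivity) ((div_le_one hx).2 hyx) h
    · positivity
  have hnonneg (j : ℕ) : 0 ≤ (if k ≤ j then y ^ (2 * j) / (Nat.factorial j : ℝ) else 0) := by
    split_ifs <;> positivity
  rw [← hexp.tsum_eq]
  exact (Summable.of_nonneg_of_le hnonneg hle hexp.summable).tsum_le_tsum hle hexp.summable

/-- The Chernoff bound for the double series, optimized at tilt `x / y`. -/
theorem tsum_mul_tsum_tail_le_exp {x y : ℝ} (hy : 0 < y) (hyx : y ≤ x) :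
    ∑' k : ℕ, (x ^ (2 * k) / (Nat.factorial k : ℝ)) *
        ∑' j : ℕ, (if k ≤ j then y ^ (2 * j) / (Nat.factorial j : ℝ) else 0) ≤
      Real.exp (x * y) * Real.exp (x * y) := by
  have hx : 0 < x := hy.trans_le hyx
  have hexp : HasSum (fun k : ℕ => (x * y) ^ k / (Nat.factorial k : ℝ) * Real.exp (x * y))
      (Real.exp (x * y) * Real.exp (x * y)) := by
    refine HasSum.mul_right _ ?_
    rw [Real.exp_eq_exp_ℝ]
    exact NormedSpace.expSeries_div_hasSum_exp (x * y)
  have hle (k : ℕ) : (x ^ (2 * k) / (Nat.factorial k : ℝ)) *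
      ∑' j : ℕ, (if k ≤ j then y ^ (2 * j) / (Nat.factorial j : ℝ) else 0) ≤
      (x * y) ^ k / (Nat.factorial k : ℝ) * Real.exp (x * y) := by
    have hpow : (x * y) ^ k = x ^ (2 * k) * (y / x) ^ k := by
      rw [pow_mul, ← mul_pow]
      congr 1
      field_simp
    calc _ ≤ (x ^ (2 * k) / (Nat.factorial k : ℝ)) * ((y / x) ^ k * Real.exp (x * y)) := by
          gcongr
          exact tsum_tail_le_exp_mul hy hyx k
      _ = _ := by rw [hpow]; ring
  have hnonneg (k : ℕ) : 0 ≤ (x ^ (2 * k) / (Nat.factorial k : ℝ)) *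
      ∑' j : ℕ, (if k ≤ j then y ^ (2 * j) / (Nat.factorial j : ℝ) else 0) :=
    mul_nonneg (by positivity) (tsum_nonneg fun j => by split_ifs <;> positivity)
  rw [← hexp.tsum_eq]
  exact (Summable.of_nonneg_of_le hnonneg hle hexp.summable).tsum_le_tsum hle hexp.summable

theorem Gker_le_exp_neg_sq {x y : ℝ} (hy : 0 < y) (hyx : y ≤ x) :
    Gker y (x - y) ≤ Real.exp (-(x - y) ^ 2) := by
  have hx : 0 < x := hy.trans_le hyx
  rw [Gker, if_pos hy.le, Gker0, sub_add_cancel, if_neg hx.not_ge]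
  calc _ ≤ Real.exp (-(x ^ 2 + y ^ 2)) * (Real.exp (x * y) * Real.exp (x * y)) := by
        gcongr
        exact tsum_mul_tsum_tail_le_exp hy hyx
    _ = _ := by
        rw [← Real.exp_add, ← Real.exp_add]
        congr 1
        ring

/-- Inequality (4.19): there is `C₃ > 0` such that for all `y > 2` and `x ≥ y`,
`Ḡ(y, x-y) ≤ C₃ √(xy) e^{-(x-y)²}`. -/
theorem cover_kernel_gaussian_upper_bound :
    ∃ C₃ : ℝ, 0 < C₃ ∧ ∀ x y : ℝ, 2 < y → y ≤ x →
      Gker y (x - y) ≤ C₃ * Real.sqrt (x * y) * Real.exp (-(x - y) ^ 2) := by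
  refine ⟨1, one_pos, fun x y hy hyx => ?_⟩
  have hsqrt : 1 ≤ Real.sqrt (x * y) := Real.one_le_sqrt.2 (by nlinarith)
  rw [one_mul]
  exact (Gker_le_exp_neg_sq (by linarith) hyx).trans
    (le_mul_of_one_le_left (Real.exp_pos _).le hsqrt)
end

section
/- If a kernel Ḡ_n : ℝ × ℝ → [0,1] with Ḡ_n(y,·) ∈ 𝒟 for each y satisfies (G1) [Ḡ_n(y, x−y) is nondecreasing in y and Ḡ_n(y, x) is nonincreasing in y] and (G2') [there exist constants a' ∈ (0,1), L > 0 and M' ≥ 2L such that Ḡ_n(y − M', x + M') ≤ e^{−a'M'}·Ḡ_n(y, x) for all x ≥ L and all y ∈ ℝ], then Ḡ_n satisfies (G2) with a = a'/3 and M₀ = 2M', i.e. Ḡ_n(y − M, x + M) ≤ e^{−aM}·Ḡ_n(y, x) for all x ≥ 0, y ∈ ℝ and M ≥ M₀. -/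
open MeasureTheory Filter Set

/-- Iterating a one-step decay estimate `k` times. -/
theorem exp_decay_iterate {G : ℝ → ℝ → ℝ} {c L s : ℝ} (hs : 0 ≤ s)
    (h : ∀ x y : ℝ, L ≤ x → G (y - s) (x + s) ≤ Real.exp (-(c * s)) * G y x)
    (k : ℕ) {x : ℝ} (y : ℝ) (hx : L ≤ x) :
    G (y - k * s) (x + k * s) ≤ Real.exp (-(c * (k * s))) * G y x := by
  induction k with
  | zero => simp
  | succ k ih =>
    have hks : 0 ≤ (k : ℝ) * s := by positivity
    have hstep := h (x + k * s) (y - k * s) (by linarith)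
    have hexp : Real.exp (-(c * ((k + 1 : ℕ) * s))) =
        Real.exp (-(c * s)) * Real.exp (-(c * (k * s))) := by
      rw [← Real.exp_add]
      push_cast
      ring_nf
    calc G (y - (k + 1 : ℕ) * s) (x + (k + 1 : ℕ) * s)
        = G (y - k * s - s) (x + k * s + s) := by
          push_cast
          ring_nf
      _ ≤ Real.exp (-(c * s)) * G (y - k * s) (x + k * s) := hstep
      _ ≤ Real.exp (-(c * s)) * (Real.exp (-(c * (k * s))) * G y x) := by gcongr
      _ = Real.exp (-(c * ((k + 1 : ℕ) * s))) * G y x := by rw [hexp, mul_assoc]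

/-- Monotonicity along antidiagonals: shifting by `(-s, s)` is decreasing in `s`. -/
theorem antidiagonal_antitone {G : ℝ → ℝ → ℝ} (hG : ∀ x : ℝ, Monotone fun y => G y (x - y))
    (x y : ℝ) : Antitone fun s => G (y - s) (x + s) := by
  intro s t hst
  have h := hG (x + y) (show y - t ≤ y - s by linarith)
  simpa [show x + y - (y - t) = x + t by ring, show x + y - (y - s) = x + s by ring] using h

/-- (G1) and (G2') imply (G2) with `a = a'/3` and `M₀ = 2M'`. -/
theorem g2'_implies_g2
    (Gn : ℝ → ℝ → ℝ) (hD : ∀ y, MemD (Gn y))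
    (hG1a : ∀ x : ℝ, Monotone fun y => Gn y (x - y))
    (hG1b : ∀ x : ℝ, Antitone fun y => Gn y x)
    (a' L M' : ℝ) (ha'0 : 0 < a') (ha'1 : a' < 1) (hL : 0 < L) (hM' : 2 * L ≤ M')
    (hG2' : ∀ x y : ℝ, L ≤ x → Gn (y - M') (x + M') ≤ Real.exp (-(a' * M')) * Gn y x) :
    ∀ x y M : ℝ, 0 ≤ x → 2 * M' ≤ M →
      Gn (y - M) (x + M) ≤ Real.exp (-(a' / 3 * M)) * Gn y x := by
  intro x y M hx hM
  have hM'0 : 0 < M' := by linarith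
  set k : ℕ := ⌊(M - L) / M'⌋₊
  have hk_le : (k : ℝ) * M' ≤ M - L :=
    (le_div_iff₀ hM'0).1 (Nat.floor_le (div_nonneg (by linarith) hM'0.le))
  have hk_lt : M - L < (k + 1) * M' := (div_lt_iff₀ hM'0).1 (Nat.lt_floor_add_one _)
  have hk_one : (1 : ℝ) ≤ k := by
    have : 1 ≤ k := Nat.le_floor (by
      rw [Nat.cast_one, le_div_iff₀ hM'0]
      linarith)
    exact_mod_cast this
  have hM_le : M / 3 ≤ k * M' := by nlinarith
  have hG0 : 0 ≤ Gn y x := ((hD y).2.2.1 x).1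
  have hanti := antidiagonal_antitone hG1a x y
  calc Gn (y - M) (x + M)
      ≤ Gn (y - (L + k * M')) (x + (L + k * M')) := hanti (by linarith)
    _ = Gn (y - L - k * M') (x + L + k * M') := by rw [sub_sub, add_assoc]
    _ ≤ Real.exp (-(a' * (k * M'))) * Gn (y - L) (x + L) :=
        exp_decay_iterate hM'0.le hG2' k (y - L) (by linarith)
    _ ≤ Real.exp (-(a' * (k * M'))) * Gn y x := by
        gcongr
        simpa using hanti hL.le
    _ ≤ Real.exp (-(a' / 3 * M)) * Gn y x := by
        refine mul_le_mul_of_nonneg_right (Real.exp_le_exp.2 ?_) hG0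
        linarith [mul_le_mul_of_nonneg_left hM_le ha'0.le]
end

section
/- Lower bound (4.2) for the offspring generating transform: let {p_k}_{k≥1} be a probability distribution on the positive integers with m₁ = ∑_{k≥1} k·p_k < ∞ and m_θ = ∑_{k≥1} k^θ·p_k < ∞ for some θ ∈ (1,2], and set Q(u) = 1 − ∑_{k≥1} p_k·(1−u)^k for u ∈ [0,1]. Then there exist constants c > 0 and δ > 0 such that Q(x) ≥ m₁·x − c·x^θ for all x ∈ [0, δ]. -/
/-- A second-order Bernoulli-type upper bound with a fractional exponent. -/
lemma one_sub_pow_le_one_sub_add_rpow {θ x : ℝ} (hθ1 : 1 ≤ θ) (hθ2 : θ ≤ 2)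
    (hx0 : 0 ≤ x) (hx1 : x ≤ 1) (k : ℕ) :
    (1 - x) ^ k ≤ 1 - k * x + (k : ℝ) ^ θ * x ^ θ := by
  have hk : (0 : ℝ) ≤ k := k.cast_nonneg
  rw [← Real.mul_rpow hk hx0]
  have hy : 0 ≤ (k : ℝ) * x := mul_nonneg hk hx0
  rcases le_total ((k : ℝ) * x) 1 with h | h
  · have hexp : (1 - x) ^ k ≤ Real.exp (-(k * x)) := by
      calc (1 - x) ^ k ≤ Real.exp (-x) ^ k :=
            pow_le_pow_left₀ (by linarith) (Real.one_sub_le_exp_neg x) k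
        _ = Real.exp (-(k * x)) := by rw [← Real.exp_nat_mul]; ring_nf
    have hquad := (abs_le.mp (Real.abs_exp_sub_one_sub_id_le (x := -(k * x))
      (by rwa [abs_neg, abs_of_nonneg hy]))).2
    have hpow : ((k : ℝ) * x) ^ 2 ≤ ((k : ℝ) * x) ^ θ := by
      rw [← Real.rpow_two]
      exact Real.rpow_le_rpow_of_exponent_ge' hy h (by linarith) hθ2
    rw [neg_sq] at hquad
    linarith
  · have hpow := Real.self_le_rpow_of_one_le h hθ1
    have hone : (1 - x) ^ k ≤ 1 := pow_le_one₀ (by linarith) (by linarith)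
    linarith


/-- Lower bound (4.2) for the offspring generating transform: if `{p_k}` is a
probability distribution on the positive integers with `m₁ = ∑ k p_k < ∞` and
`m_θ = ∑ k^θ p_k < ∞` for some `θ ∈ (1,2]`, then there are `c > 0` and `δ > 0` with
`Q(x) ≥ m₁ x - c x^θ` for all `x ∈ [0, δ]`, where `Q(u) = 1 - ∑ p_k (1-u)^k`. -/
theorem generating_function_lower_bound
    (p : ℕ → ℝ) (hp0 : ∀ k, 0 ≤ p k) (hp00 : p 0 = 0)
    (hpsum : ∑' k : ℕ, p k = 1)
    (hm1 : Summable fun k : ℕ => (k : ℝ) * p k)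
    (θ : ℝ) (hθ1 : 1 < θ) (hθ2 : θ ≤ 2)
    (hmθ : Summable fun k : ℕ => (k : ℝ) ^ θ * p k) :
    ∃ c : ℝ, 0 < c ∧ ∃ δ : ℝ, 0 < δ ∧ ∀ x : ℝ, 0 ≤ x → x ≤ δ →
      (∑' k : ℕ, (k : ℝ) * p k) * x - c * x ^ θ ≤
        1 - ∑' k : ℕ, p k * (1 - x) ^ k := by
  have hp : Summable p := by
    by_contra h
    rw [tsum_eq_zero_of_not_summable h] at hpsum
    exact zero_ne_one hpsum
  have hmθ0 : 0 ≤ ∑' k : ℕ, (k : ℝ) ^ θ * p k :=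
    tsum_nonneg fun k => mul_nonneg (Real.rpow_nonneg k.cast_nonneg θ) (hp0 k)
  refine ⟨(∑' k : ℕ, (k : ℝ) ^ θ * p k) + 1, by linarith, 1, one_pos, fun x hx0 hx1 => ?_⟩
  have hsum : Summable fun k : ℕ => p k * (1 - x) ^ k :=
    Summable.of_nonneg_of_le
      (fun k => mul_nonneg (hp0 k) (pow_nonneg (by linarith) k))
      (fun k => mul_le_of_le_one_right (hp0 k) (pow_le_one₀ (by linarith) (by linarith))) hp
  have hbound := (hp.hasSum.sub (hm1.hasSum.mul_right x)).add (hmθ.hasSum.mul_right (x ^ θ))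
  have hle := hasSum_le (fun k => ?_) hsum.hasSum hbound
  · rw [hpsum] at hle
    have hxθ := Real.rpow_nonneg hx0 θ
    linarith
  · have h := mul_le_mul_of_nonneg_left
      (one_sub_pow_le_one_sub_add_rpow hθ1.le hθ2 hx0 hx1 k) (hp0 k)
    linarith
end

section
/- Verification of Assumption 2.1 for branching random walk: let {p_k}_{k≥1} be a probability distribution on the positive integers with p₁ < 1, m₁ = ∑_{k≥1} k·p_k (so m₁ > 1, allowing m₁ = ∞) and m_θ = ∑_{k≥1} k^θ·p_k < ∞ for some θ ∈ (1,2], set Q(u) = 1 − ∑_{k≥1} p_k·(1−u)^k, and let m = (1 + (m₁ − 1)/2) ∧ 2 ∈ (1,2]. Then there exist δ₀ > 0 and c* > 0 such that Q(x) ≥ m·x for all x ∈ [0, 2δ₀], and x₂/x₁ ≤ (Q(x₂)/Q(x₁))·(1 + c*·(Q(x₁))^{θ−1}) for all 0 < x₁ < x₂ ≤ 2·(δ₀ ∧ x₁); that is, Q satisfies Assumption 2.1 with θ* = θ − 1. -/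
open scoped ENNReal

/-- The offspring generating transform `Q(u) = 1 - ∑ₖ p_k (1-u)^k`. -/
noncomputable def Qgen (p : ℕ → ℝ) (u : ℝ) : ℝ := 1 - ∑' k : ℕ, p k * (1 - u) ^ k

/-- `m = (1 + (m₁ - 1)/2) ∧ 2`, where `m₁ = ∑ₖ k p_k ∈ (1, ∞]` is the mean number of
offspring (computed in `ℝ≥0∞` to allow `m₁ = ∞`). -/
noncomputable def mBranch (p : ℕ → ℝ) : ℝ :=
  (min (1 + ((∑' k : ℕ, (k : ℝ≥0∞) * ENNReal.ofReal (p k)) - 1) / 2) 2).toReal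

theorem one_sub_pow_le_quadratic {u : ℝ} (h0 : 0 ≤ u) (h1 : u ≤ 1) (k : ℕ) :
    (1 - u) ^ k ≤ 1 - k * u + (k * u) ^ 2 := by
  induction k with
  | zero => simp
  | succ k ih =>
    have h := mul_le_mul_of_nonneg_right ih (sub_nonneg.2 h1)
    have hk : (0 : ℝ) ≤ k := k.cast_nonneg
    rw [pow_succ]
    push_cast
    nlinarith [mul_nonneg hk (sq_nonneg u), mul_nonneg (sq_nonneg (k * u)) h0, sq_nonneg u]

theorem one_sub_pow_le_rpow {u θ : ℝ} (h0 : 0 ≤ u) (h1 : u ≤ 1) (hθ1 : 1 < θ) (hθ2 : θ ≤ 2)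
    (k : ℕ) : (1 - u) ^ k ≤ 1 - k * u + (k : ℝ) ^ θ * u ^ θ := by
  have hk : (0 : ℝ) ≤ k := k.cast_nonneg
  have hku : 0 ≤ k * u := mul_nonneg hk h0
  rw [← Real.mul_rpow hk h0]
  rcases le_total (k * u) 1 with h | h
  · have h2 : (k * u) ^ (2 : ℝ) ≤ (k * u) ^ θ :=
      Real.rpow_le_rpow_of_exponent_ge_of_imp hku h hθ2 (fun _ hθ => by linarith)
    rw [Real.rpow_two] at h2
    linarith [one_sub_pow_le_quadratic h0 h1 k]
  · have h2 : (k * u) ^ (1 : ℝ) ≤ (k * u) ^ θ :=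
      Real.rpow_le_rpow_of_exponent_le h hθ1.le
    rw [Real.rpow_one] at h2
    linarith [pow_le_one₀ (n := k) (sub_nonneg.2 h1) (sub_le_self 1 h0)]

section Offspring

variable {p : ℕ → ℝ} {θ : ℝ}

theorem summable_mean_of_summable_rpow (hp0 : ∀ k, 0 ≤ p k) (hθ1 : 1 < θ)
    (hmθ : Summable fun k : ℕ => (k : ℝ) ^ θ * p k) : Summable fun k : ℕ => (k : ℝ) * p k := by
  refine hmθ.of_nonneg_of_le (fun k => mul_nonneg k.cast_nonneg (hp0 k)) fun k => ?_
  refine mul_le_mul_of_nonneg_right ?_ (hp0 k)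
  rcases k.eq_zero_or_pos with rfl | hk
  · simp [Real.zero_rpow (by linarith : θ ≠ 0)]
  · simpa using Real.rpow_le_rpow_of_exponent_le (Nat.one_le_cast.2 hk) hθ1.le

theorem one_lt_tsum_mean (hp0 : ∀ k, 0 ≤ p k) (hp00 : p 0 = 0) (hs : HasSum p 1) (hp1 : p 1 < 1)
    (hm : Summable fun k : ℕ => (k : ℝ) * p k) : 1 < ∑' k : ℕ, (k : ℝ) * p k := by
  have h := (hs.mul_left 2).sub (hasSum_ite_eq 1 (p 1))
  have hle := hasSum_le (fun k => ?_) h hm.hasSum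
  · linarith
  · split_ifs with hk
    · subst hk
      norm_num
      linarith
    · rcases k.eq_zero_or_pos with rfl | hpos
      · simp [hp00]
      · have : (2 : ℝ) ≤ k := by exact_mod_cast (show 2 ≤ k by omega)
        simpa using mul_le_mul_of_nonneg_right this (hp0 k)

theorem mBranch_eq_of_summable (hp0 : ∀ k, 0 ≤ p k)
    (hm : Summable fun k : ℕ => (k : ℝ) * p k) (h1 : 1 < ∑' k : ℕ, (k : ℝ) * p k) :
    mBranch p = min (1 + ((∑' k : ℕ, (k : ℝ) * p k) - 1) / 2) 2 := by
  have he : ∑' k : ℕ, (k : ℝ≥0∞) * ENNReal.ofReal (p k)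
      = ENNReal.ofReal (∑' k : ℕ, (k : ℝ) * p k) := by
    rw [ENNReal.ofReal_tsum_of_nonneg (fun k => mul_nonneg k.cast_nonneg (hp0 k)) hm]
    refine tsum_congr fun k => ?_
    rw [ENNReal.ofReal_mul k.cast_nonneg, ENNReal.ofReal_natCast]
  rw [mBranch, he]
  generalize (∑' k : ℕ, (k : ℝ) * p k) = M at h1
  have hne : 1 + (ENNReal.ofReal M - 1) / 2 ≠ ∞ := by finiteness
  rw [ENNReal.toReal_min hne (by simp), ENNReal.toReal_add (by simp) (by finiteness),
    ENNReal.toReal_div, ENNReal.toReal_sub_of_le (by simpa using h1.le) (by simp),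
    ENNReal.toReal_ofReal (by linarith)]
  simp

theorem summable_mul_one_sub_pow (hp0 : ∀ k, 0 ≤ p k) (hs : HasSum p 1) {u : ℝ}
    (h0 : 0 ≤ u) (h1 : u ≤ 1) : Summable fun k : ℕ => p k * (1 - u) ^ k :=
  hs.summable.of_nonneg_of_le
    (fun k => mul_nonneg (hp0 k) (pow_nonneg (sub_nonneg.2 h1) k))
    fun k => mul_le_of_le_one_right (hp0 k)
      (pow_le_one₀ (sub_nonneg.2 h1) (sub_le_self 1 h0))

theorem Qgen_le_mean_mul (hp0 : ∀ k, 0 ≤ p k) (hs : HasSum p 1)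
    (hm : Summable fun k : ℕ => (k : ℝ) * p k) {u : ℝ} (h0 : 0 ≤ u) (h1 : u ≤ 1) :
    Qgen p u ≤ (∑' k : ℕ, (k : ℝ) * p k) * u := by
  have hle := hasSum_le (fun k => ?_) (hs.sub (hm.hasSum.mul_right u))
    (summable_mul_one_sub_pow hp0 hs h0 h1).hasSum
  · rw [Qgen]
    linarith
  · have hb : 1 - k * u ≤ (1 - u) ^ k := by
      simpa [sub_eq_add_neg] using one_add_mul_le_pow (by linarith : -2 ≤ -u) k
    linarith [mul_le_mul_of_nonneg_left hb (hp0 k)]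

theorem mean_mul_sub_rpow_le_Qgen (hp0 : ∀ k, 0 ≤ p k) (hs : HasSum p 1)
    (hm : Summable fun k : ℕ => (k : ℝ) * p k) (hθ1 : 1 < θ) (hθ2 : θ ≤ 2)
    (hmθ : Summable fun k : ℕ => (k : ℝ) ^ θ * p k) {u : ℝ} (h0 : 0 ≤ u) (h1 : u ≤ 1) :
    (∑' k : ℕ, (k : ℝ) * p k) * u - (∑' k : ℕ, (k : ℝ) ^ θ * p k) * u ^ θ ≤ Qgen p u := by
  have hle := hasSum_le (fun k => ?_) (summable_mul_one_sub_pow hp0 hs h0 h1).hasSum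
    ((hs.sub (hm.hasSum.mul_right u)).add (hmθ.hasSum.mul_right (u ^ θ)))
  · rw [Qgen]
    linarith
  · linarith [mul_le_mul_of_nonneg_left (one_sub_pow_le_rpow h0 h1 hθ1 hθ2 k) (hp0 k)]

end Offspring

/-- Verification of Assumption 2.1 for branching random walk: with `p₁ < 1` and
`m_θ < ∞` for some `θ ∈ (1,2]`, the function `Q` satisfies Assumption 2.1 with
`m = (1 + (m₁-1)/2) ∧ 2 ∈ (1,2]` and `θ* = θ - 1`. -/
theorem brw_satisfies_assumption21
    (p : ℕ → ℝ) (hp0 : ∀ k, 0 ≤ p k) (hp00 : p 0 = 0)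
    (hpsum : ∑' k : ℕ, p k = 1) (hp1 : p 1 < 1)
    (θ : ℝ) (hθ1 : 1 < θ) (hθ2 : θ ≤ 2)
    (hmθ : Summable fun k : ℕ => (k : ℝ) ^ θ * p k) :
    1 < mBranch p ∧ mBranch p ≤ 2 ∧
    ∃ δ₀ : ℝ, 0 < δ₀ ∧ ∃ cs : ℝ, 0 < cs ∧
      (∀ x : ℝ, 0 ≤ x → x ≤ 2 * δ₀ → mBranch p * x ≤ Qgen p x) ∧
      (∀ x₁ x₂ : ℝ, 0 < x₁ → x₁ < x₂ → x₂ ≤ 2 * min δ₀ x₁ →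
        x₂ / x₁ ≤ (Qgen p x₂ / Qgen p x₁) * (1 + cs * (Qgen p x₁) ^ (θ - 1))) := by
  have hs : HasSum p 1 := by
    have hsum : Summable p := by
      by_contra h
      simp [tsum_eq_zero_of_not_summable h] at hpsum
    exact hpsum ▸ hsum.hasSum
  have hm := summable_mean_of_summable_rpow hp0 hθ1 hmθ
  have hM := one_lt_tsum_mean hp0 hp00 hs hp1 hm
  have hmB := mBranch_eq_of_summable hp0 hm hM
  have hupper := fun u => Qgen_le_mean_mul (u := u) hp0 hs hm
  have hlower := fun u => mean_mul_sub_rpow_le_Qgen (u := u) hp0 hs hm hθ1 hθ2 hmθ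
  have hS : 0 ≤ ∑' k : ℕ, (k : ℝ) ^ θ * p k :=
    tsum_nonneg fun k => mul_nonneg (Real.rpow_nonneg k.cast_nonneg θ) (hp0 k)
  generalize (∑' k : ℕ, (k : ℝ) * p k) = M at *
  generalize (∑' k : ℕ, (k : ℝ) ^ θ * p k) = S at *
  have hmB1 : 1 < mBranch p := hmB ▸ lt_min (by linarith) one_lt_two
  have hmBM : mBranch p ≤ M - (M - 1) / 2 := hmB ▸ (min_le_left _ _).trans (by linarith)
  have hθ : 0 < θ - 1 := sub_pos.2 hθ1
  set c := (M - 1) / (2 * (S + 1)) with hc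
  have hcpos : 0 < c := div_pos (by linarith) (by linarith)
  have hSc : S * c ≤ (M - 1) / 2 := by
    rw [hc, ← mul_div_assoc, div_le_div_iff₀ (by linarith) two_pos]
    nlinarith
  set δ := min 1 (c ^ (θ - 1)⁻¹) / 2 with hδ
  have hδpos : 0 < δ := half_pos (lt_min one_pos (Real.rpow_pos_of_pos hcpos _))
  have hδ1 : 2 * δ ≤ 1 := by
    rw [hδ, mul_div_cancel₀ _ two_ne_zero]
    exact min_le_left _ _
  have hpow : ∀ x, 0 ≤ x → x ≤ 2 * δ → S * x ^ (θ - 1) ≤ (M - 1) / 2 := by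
    intro x hx0 hx
    have hxc : x ≤ c ^ (θ - 1)⁻¹ := by
      rw [hδ, mul_div_cancel₀ _ two_ne_zero] at hx
      exact hx.trans (min_le_right _ _)
    have h := Real.rpow_le_rpow hx0 hxc hθ.le
    rw [Real.rpow_inv_rpow hcpos.le hθ.ne'] at h
    exact (mul_le_mul_of_nonneg_left h hS).trans hSc
  have hfactor : ∀ x, 0 < x → x ≤ 2 * δ → x * (M - S * x ^ (θ - 1)) ≤ Qgen p x := by
    intro x hx0 hx
    refine le_trans (le_of_eq ?_) (hlower x hx0.le (hx.trans hδ1))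
    rw [Real.rpow_sub_one hx0.ne']
    field_simp
  have hQ : ∀ x, 0 ≤ x → x ≤ 2 * δ → mBranch p * x ≤ Qgen p x := by
    intro x hx0 hx
    rcases hx0.eq_or_lt with rfl | hx0
    · simp [Qgen, hpsum]
    · refine le_trans ?_ (hfactor x hx0 hx)
      rw [mul_comm]
      exact mul_le_mul_of_nonneg_left (by linarith [hpow x hx0.le hx]) hx0.le
  refine ⟨hmB1, hmB ▸ min_le_right _ _, δ, hδpos, 2 * S + 1, by linarith, hQ, ?_⟩
  intro x₁ x₂ hx₁ hlt hx₂
  have hx₂pos : 0 < x₂ := hx₁.trans hlt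
  have h2δ : x₂ ≤ 2 * δ := hx₂.trans (by linarith [min_le_left δ x₁])
  have h2x : x₂ ≤ 2 * x₁ := hx₂.trans (by linarith [min_le_right δ x₁])
  have hx₁Q : x₁ ≤ Qgen p x₁ :=
    (le_mul_of_one_le_left hx₁.le hmB1.le).trans (hQ x₁ hx₁.le (hlt.le.trans h2δ))
  have hQ₁ : 0 < Qgen p x₁ := hx₁.trans_le hx₁Q
  have hQ₂ : 0 < Qgen p x₂ :=
    (mul_pos (by linarith) hx₂pos).trans_le (hQ x₂ hx₂pos.le h2δ)
  have hup := hupper x₁ hx₁.le (by linarith)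
  have ht : x₂ ^ (θ - 1) ≤ 2 * Qgen p x₁ ^ (θ - 1) := by
    calc x₂ ^ (θ - 1) ≤ (2 * Qgen p x₁) ^ (θ - 1) :=
          Real.rpow_le_rpow hx₂pos.le (by linarith) hθ.le
      _ = 2 ^ (θ - 1) * Qgen p x₁ ^ (θ - 1) := Real.mul_rpow two_pos.le hQ₁.le
      _ ≤ 2 * Qgen p x₁ ^ (θ - 1) := by
          refine mul_le_mul_of_nonneg_right ?_ (Real.rpow_nonneg hQ₁.le _)
          simpa using Real.rpow_le_rpow_of_exponent_le one_le_two (by linarith : θ - 1 ≤ 1)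
  have hlow := hfactor x₂ hx₂pos h2δ
  have hp2 := hpow x₂ hx₂pos.le h2δ
  have hq : 0 < Qgen p x₁ ^ (θ - 1) := Real.rpow_pos_of_pos hQ₁ _
  generalize x₂ ^ (θ - 1) = t at *
  generalize Qgen p x₁ ^ (θ - 1) = q at *
  have hr : 0 ≤ (2 * S + 1) * q := mul_nonneg (by linarith) hq.le
  have hMle : M ≤ (M - S * t) * (1 + (2 * S + 1) * q) := by
    nlinarith [mul_le_mul_of_nonneg_left ht hS,
      mul_nonneg (by linarith : 0 ≤ M - S * t - 1) hr]
  have hkey : M * x₂ ≤ Qgen p x₂ * (1 + (2 * S + 1) * q) := by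
    calc M * x₂ ≤ x₂ * (M - S * t) * (1 + (2 * S + 1) * q) := by
          rw [mul_assoc, mul_comm M]
          exact mul_le_mul_of_nonneg_left hMle hx₂pos.le
      _ ≤ _ := mul_le_mul_of_nonneg_right hlow (by linarith)
  rw [div_mul_eq_mul_div, div_le_div_iff₀ hx₁ hQ₁]
  calc x₂ * Qgen p x₁ ≤ x₂ * (M * x₁) := mul_le_mul_of_nonneg_left hup hx₂pos.le
    _ = M * x₂ * x₁ := by ring
    _ ≤ _ := mul_le_mul_of_nonneg_right hkey hx₁.le
end
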